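/- There exists a universal constant C_LT > 0 such that for every α ∈ ℝ and N ≥ 2 with C_{α,N} > 0, every normalized N-anyon wave function u, and every measurable function V : ℝ² → ℝ whose negative part V₋ := max(−V,0) is square integrable: ∑_{j=1}^N ∫_{(ℝ²)^N} (|D_j u|² + V(x_j)|u|²) dx ≥ −C_LT · C_{α,N}^{−2} · ∫_{ℝ²} V₋(x)² dx, where the left-hand side is interpreted as an extended real number (equal to +∞ if the positive part of the potential term fails to be integrable). -/

import Mathlib

open MeasureTheory

noncomputable section

/-- Squared magnitude of the covariant derivative `D_j u` at configuration `x`;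
the plane `ℝ²` is identified with `ℂ` (so `a^⊥ = I·a`, and the two components of a
vector field are the real and imaginary parts). -/
def covSq (α : ℝ) {N : ℕ} (u : (Fin N → ℂ) → ℂ) (j : Fin N) (x : Fin N → ℂ) : ℝ :=
  let A : ℂ := (α : ℂ) * ∑ k ∈ Finset.univ.erase j,
    Complex.I * (x j - x k) / ((‖x j - x k‖ : ℂ) ^ 2)
  ‖-Complex.I * fderiv ℝ u x (Pi.single j 1) + (A.re : ℂ) * u x‖ ^ 2 +
    ‖-Complex.I * fderiv ℝ u x (Pi.single j Complex.I) + (A.im : ℂ) * u x‖ ^ 2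

/-- The statistics constant `C_{α,N} = min_{p ∈ {0,…,N-2}} min_{q ∈ ℤ} |(2p+1)α - 2q|`. -/
def statC (α : ℝ) (N : ℕ) : ℝ :=
  ⨅ p : Fin (N - 1), ⨅ q : ℤ, |(2 * ((p : ℕ) : ℝ) + 1) * α - 2 * (q : ℝ)|

/-- `N`-anyon wave function in the magnetic gauge (smooth compactly supported
form-core representative): totally symmetric with support away from the diagonals. -/
structure IsAnyonWF (N : ℕ) (u : (Fin N → ℂ) → ℂ) : Prop where
  smooth : ContDiff ℝ (⊤ : ℕ∞) u
  compactSupport : HasCompactSupport u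
  symmetric : ∀ (σ : Equiv.Perm (Fin N)) (x : Fin N → ℂ), u (x ∘ σ) = u x
  offDiagonal : ∀ x ∈ tsupport u, ∀ j k : Fin N, j ≠ k → x j ≠ x k

/-- One-particle density of an `N`-particle wave function. -/
def density (N : ℕ) (u : (Fin N → ℂ) → ℂ) (y : ℂ) : ℝ :=
  ∑ j : Fin N, ∫ z : {k : Fin N // k ≠ j} → ℂ,
    ‖u (fun k => if h : k = j then y else z ⟨k, h⟩)‖ ^ 2

namespace Anyon

open Set Filter Complex
open scoped ENNReal Topology

lemma norm_sub_le_setIntegral {F F' : ℝ → ℂ} (hF : ∀ s, HasDerivAt F (F' s) s)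
    (hF' : Continuous F') {p ℓ a c : ℝ} (ha : a ∈ Icc p (p + ℓ)) (hc : c ∈ Icc p (p + ℓ)) :
    ‖F c - F a‖ ≤ ∫ s in Ioc p (p + ℓ), ‖F' s‖ := by
  rw [← intervalIntegral.integral_eq_sub_of_hasDerivAt (fun s _ => hF s)
    (hF'.intervalIntegrable _ _)]
  refine (intervalIntegral.norm_integral_le_integral_norm_uIoc).trans ?_
  refine setIntegral_mono_set ?_ (ae_of_all _ fun s => norm_nonneg _) ?_
  · exact (hF'.norm.integrableOn_Icc).mono_set Ioc_subset_Icc_self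
  · exact (Ioc_subset_Ioc (le_min ha.1 hc.1) (max_le ha.2 hc.2)).eventuallyLE

lemma sq_setIntegral_le {h : ℝ → ℝ} (hh : Continuous h) (p : ℝ) {ℓ : ℝ} (hℓ : 0 < ℓ) :
    (∫ s in Ioc p (p + ℓ), h s) ^ 2 ≤ ℓ * ∫ s in Ioc p (p + ℓ), h s ^ 2 := by
  have hint : ∀ {k : ℝ → ℝ}, Continuous k → IntegrableOn k (Ioc p (p + ℓ)) := fun hk =>
    hk.integrableOn_Icc.mono_set Ioc_subset_Icc_self
  set M := ∫ s in Ioc p (p + ℓ), h s with hM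
  have key : 0 ≤ ∫ s in Ioc p (p + ℓ), (h s - M / ℓ) ^ 2 :=
    integral_nonneg fun s => sq_nonneg _
  have hexp : ∫ s in Ioc p (p + ℓ), (h s - M / ℓ) ^ 2
      = (∫ s in Ioc p (p + ℓ), h s ^ 2) - M ^ 2 / ℓ := by
    have : ∀ s, (h s - M / ℓ) ^ 2 = h s ^ 2 - 2 * (M / ℓ) * h s + (M / ℓ) ^ 2 := fun s => by ring
    simp_rw [this]
    rw [integral_add (by exact hint (by fun_prop)) (by exact hint (by fun_prop)),
      integral_sub (by exact hint (by fun_prop)) (by exact hint (by fun_prop)),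
      integral_const_mul, ← hM]
    simp [hℓ.le]
    field_simp
    ring
  rw [hexp] at key
  have := mul_nonneg hℓ.le key
  rw [mul_sub, mul_div_cancel₀ _ hℓ.ne'] at this
  linarith

lemma ofReal_setIntegral_eq {h : ℝ → ℝ} (hh : Continuous h) (h0 : ∀ s, 0 ≤ h s) (p q : ℝ) :
    ENNReal.ofReal (∫ s in Ioc p q, h s) = ∫⁻ s in Ioc p q, ENNReal.ofReal (h s) :=
  ofReal_integral_eq_lintegral_ofReal
    (hh.integrableOn_Icc.mono_set Ioc_subset_Icc_self) (ae_of_all _ h0)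

/-- Parallel transport along a line: the gauge-transformed difference of the end values is
controlled by the covariant derivative. -/
lemma transport_sq {g g' : ℝ → ℂ} {θ θ' : ℝ → ℝ} (hg : ∀ s, HasDerivAt g (g' s) s)
    (hg' : Continuous g') (hθ : ∀ s, HasDerivAt θ (θ' s) s) (hθ' : Continuous θ')
    {p ℓ a c : ℝ} (hℓ : 0 < ℓ) (ha : a ∈ Icc p (p + ℓ)) (hc : c ∈ Icc p (p + ℓ)) :
    ENNReal.ofReal (‖exp (I * θ c) * g c - exp (I * θ a) * g a‖ ^ 2) ≤
      ENNReal.ofReal ℓ * ∫⁻ s in Ioc p (p + ℓ),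
        ENNReal.ofReal (‖-I * g' s + (θ' s : ℂ) * g s‖ ^ 2) := by
  have hgc : Continuous g := continuous_iff_continuousAt.2 fun s => (hg s).continuousAt
  have hθc : Continuous θ := continuous_iff_continuousAt.2 fun s => (hθ s).continuousAt
  have hF : ∀ s, HasDerivAt (fun s => exp (I * θ s) * g s)
      (exp (I * θ s) * (I * θ' s) * g s + exp (I * θ s) * g' s) s := fun s =>
    (((hθ s).ofReal_comp.const_mul I).cexp).mul (hg s)
  have h1 := norm_sub_le_setIntegral hF (by fun_prop) ha hc
  have h2 : ∀ s, ‖exp (I * θ s) * (I * θ' s) * g s + exp (I * θ s) * g' s‖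
      = ‖-I * g' s + (θ' s : ℂ) * g s‖ := fun s => by
    have : exp (I * θ s) * (I * θ' s) * g s + exp (I * θ s) * g' s
        = exp (θ s * I) * (I * (-I * g' s + (θ' s : ℂ) * g s)) := by
      rw [mul_comm I (θ s : ℂ)]
      linear_combination (exp (θ s * I) * g' s) * I_mul_I
    rw [this, norm_mul, norm_exp_ofReal_mul_I, norm_mul, norm_I, one_mul, one_mul]
  simp_rw [h2] at h1
  rw [← ofReal_setIntegral_eq (by fun_prop) (fun s => sq_nonneg _),
    ← ENNReal.ofReal_mul hℓ.le]
  refine ENNReal.ofReal_le_ofReal (le_trans (pow_le_pow_left₀ (norm_nonneg _) h1 2) ?_)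
  exact sq_setIntegral_le (by fun_prop) p hℓ

/-- Pointwise bound of a density along a segment, using only the covariant derivative. -/
lemma density_segment_le {g g' : ℝ → ℂ} (hg : ∀ s, HasDerivAt g (g' s) s)
    (hg' : Continuous g') (A : ℝ → ℝ) {p ℓ c t : ℝ} (hℓ : 0 < ℓ) (ht : 0 < t)
    (hc : c ∈ Icc p (p + ℓ)) :
    ENNReal.ofReal (‖g c‖ ^ 2) ≤ ∫⁻ s in Ioc p (p + ℓ),
      (ENNReal.ofReal (1 / ℓ + t) * ENNReal.ofReal (‖g s‖ ^ 2) +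
        ENNReal.ofReal (1 / t) * ENNReal.ofReal (‖-I * g' s + (A s : ℂ) * g s‖ ^ 2)) := by
  have hgc : Continuous g := continuous_iff_continuousAt.2 fun s => (hg s).continuousAt
  have hint : ∀ {k : ℝ → ℝ}, Continuous k → IntegrableOn k (Ioc p (p + ℓ)) := fun hk =>
    hk.integrableOn_Icc.mono_set Ioc_subset_Icc_self
  have hF : ∀ s, HasDerivAt (fun s => g s * (starRingEnd ℂ) (g s))
      (g' s * (starRingEnd ℂ) (g s) + g s * (starRingEnd ℂ) (g' s)) s := fun s =>
    (hg s).mul ((hg s).star)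
  have hcont : Continuous fun s => g' s * (starRingEnd ℂ) (g s) + g s * (starRingEnd ℂ) (g' s) := by
    fun_prop
  set k : ℝ → ℝ := fun s =>
    ‖g' s * (starRingEnd ℂ) (g s) + g s * (starRingEnd ℂ) (g' s)‖ with hk
  have hkc : Continuous k := hcont.norm
  have hsq : ∀ s, ‖g s * (starRingEnd ℂ) (g s)‖ = ‖g s‖ ^ 2 := fun s => by
    rw [norm_mul, RCLike.norm_conj, sq]
  have h1 : ∀ s ∈ Icc p (p + ℓ), ‖g c‖ ^ 2 ≤ ‖g s‖ ^ 2 + ∫ r in Ioc p (p + ℓ), k r := by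
    intro s hs
    have := norm_sub_le_setIntegral hF hcont hs hc
    have h3 := norm_sub_norm_le (g c * (starRingEnd ℂ) (g c)) (g s * (starRingEnd ℂ) (g s))
    rw [hsq, hsq] at h3
    linarith
  have h2 : ‖g c‖ ^ 2 ≤ ∫ s in Ioc p (p + ℓ), (1 / ℓ * ‖g s‖ ^ 2 + k s) := by
    have h4 : ∫ s in Ioc p (p + ℓ), ‖g c‖ ^ 2 ≤
        ∫ s in Ioc p (p + ℓ), (‖g s‖ ^ 2 + ∫ r in Ioc p (p + ℓ), k r) :=
      setIntegral_mono_on (hint (by fun_prop)) (hint (by fun_prop)) measurableSet_Ioc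
        fun s hs => h1 s (Ioc_subset_Icc_self hs)
    rw [integral_add (by exact hint (by fun_prop)) (by exact hint (by fun_prop))] at h4
    rw [integral_add (by exact hint (by fun_prop)) (by exact hint (by fun_prop)),
      integral_const_mul]
    simp [hℓ.le] at h4
    rw [← sub_nonneg] at h4 ⊢
    have := div_nonneg h4 hℓ.le
    field_simp at this ⊢
    linarith
  refine (ENNReal.ofReal_le_ofReal h2).trans ?_
  rw [ofReal_setIntegral_eq (by fun_prop) (fun s => by positivity)]
  refine lintegral_mono fun s => ?_
  rw [← ENNReal.ofReal_mul (by positivity), ← ENNReal.ofReal_mul (by positivity),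
    ← ENNReal.ofReal_add (by positivity) (by positivity)]
  refine ENNReal.ofReal_le_ofReal ?_
  have h5 : k s ≤ 2 * ‖g s‖ * ‖-I * g' s + (A s : ℂ) * g s‖ := by
    have : g' s * (starRingEnd ℂ) (g s) + g s * (starRingEnd ℂ) (g' s)
        = I * (-I * g' s + (A s : ℂ) * g s) * (starRingEnd ℂ) (g s)
          + (starRingEnd ℂ) (I * (-I * g' s + (A s : ℂ) * g s)) * g s := by
      simp only [map_mul, map_add, map_neg, conj_I, conj_ofReal, neg_neg]
      linear_combination (g' s * (starRingEnd ℂ) (g s) + (starRingEnd ℂ) (g' s) * g s) * I_mul_I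
    rw [hk]
    simp only
    rw [this]
    refine (norm_add_le _ _).trans (le_of_eq ?_)
    simp only [norm_mul, RCLike.norm_conj, norm_I]
    ring
  set X := ‖g s‖
  set Y := ‖-I * g' s + (A s : ℂ) * g s‖
  have h6 : 2 * X * Y ≤ t * X ^ 2 + 1 / t * Y ^ 2 := by
    have := sq_nonneg (t * X - Y)
    rw [← sub_nonneg]
    have h7 : t * X ^ 2 + 1 / t * Y ^ 2 - 2 * X * Y = (t * X - Y) ^ 2 / t := by field_simp; ring
    rw [h7]; positivity
  nlinarith

/-- The magnetic vector potential felt by particle `j`. -/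
def vecPot (α : ℝ) {N : ℕ} (j : Fin N) (x : Fin N → ℂ) : ℂ :=
  (α : ℂ) * ∑ k ∈ Finset.univ.erase j, I * (x j - x k) / ((‖x j - x k‖ : ℂ) ^ 2)

/-- Horizontal component of the covariant derivative. -/
def covRe (α : ℝ) {N : ℕ} (u : (Fin N → ℂ) → ℂ) (j : Fin N) (x : Fin N → ℂ) : ℂ :=
  -I * fderiv ℝ u x (Pi.single j 1) + ((vecPot α j x).re : ℂ) * u x

/-- Vertical component of the covariant derivative. -/
def covIm (α : ℝ) {N : ℕ} (u : (Fin N → ℂ) → ℂ) (j : Fin N) (x : Fin N → ℂ) : ℂ :=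
  -I * fderiv ℝ u x (Pi.single j I) + ((vecPot α j x).im : ℂ) * u x

lemma covSq_eq (α : ℝ) {N : ℕ} (u : (Fin N → ℂ) → ℂ) (j : Fin N) (x : Fin N → ℂ) :
    covSq α u j x = ‖covRe α u j x‖ ^ 2 + ‖covIm α u j x‖ ^ 2 := rfl

section lines

variable {N : ℕ} {u : (Fin N → ℂ) → ℂ}

lemma update_line (w : Fin N → ℂ) (j : Fin N) (p e : ℂ) (s : ℝ) :
    Function.update w j (p + s * e) =
      Function.update w j p + s • (Pi.single j e : Fin N → ℂ) := by
  ext k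
  by_cases h : k = j
  · subst h; simp
  · simp [h]

lemma hasDerivAt_line (hu : ContDiff ℝ (⊤ : ℕ∞) u) (w : Fin N → ℂ) (j : Fin N) (p e : ℂ)
    (s : ℝ) :
    HasDerivAt (fun s : ℝ => u (Function.update w j (p + s * e)))
      (fderiv ℝ u (Function.update w j (p + s * e)) (Pi.single j e)) s := by
  have h1 : HasFDerivAt u (fderiv ℝ u (Function.update w j (p + s * e)))
      (Function.update w j (p + s * e)) :=
    (hu.differentiable (by simp)).differentiableAt.hasFDerivAt
  have h2 : HasDerivAt (fun s : ℝ => Function.update w j (p + s * e)) (Pi.single j e) s := by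
    simp_rw [update_line]
    simpa using ((hasDerivAt_id s).smul_const (Pi.single j e : Fin N → ℂ)).const_add
      (Function.update w j p)
  exact h1.comp_hasDerivAt s h2

lemma continuous_deriv_line (hu : ContDiff ℝ (⊤ : ℕ∞) u) (w : Fin N → ℂ) (j : Fin N) (p e : ℂ) :
    Continuous fun s : ℝ =>
      fderiv ℝ u (Function.update w j (p + s * e)) (Pi.single j e) := by
  have h2 : Continuous fun s : ℝ => Function.update w j (p + s * e) :=
    continuous_const.update j (by fun_prop)
  exact ((hu.continuous_fderiv (by simp)).comp h2).clm_apply continuous_const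

lemma mk_eq_horizontal (s b : ℝ) : (⟨s, b⟩ : ℂ) = b * I + s * 1 := by
  apply Complex.ext <;> simp

lemma mk_eq_vertical (a s : ℝ) : (⟨a, s⟩ : ℂ) = a + s * I := by
  apply Complex.ext <;> simp

lemma term_re (z : ℂ) : (I * z / ((‖z‖ : ℂ) ^ 2)).re = -z.im / (z.re ^ 2 + z.im ^ 2) := by
  rw [← ofReal_pow, div_ofReal_re, ← normSq_eq_norm_sq, normSq_apply]
  simp [sq]

lemma term_im (z : ℂ) : (I * z / ((‖z‖ : ℂ) ^ 2)).im = z.re / (z.re ^ 2 + z.im ^ 2) := by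
  rw [← ofReal_pow, div_ofReal_im, ← normSq_eq_norm_sq, normSq_apply]
  simp [sq]

lemma vecPot_re_update (α : ℝ) (w : Fin N → ℂ) (j : Fin N) (v : ℂ) :
    (vecPot α j (Function.update w j v)).re = ∑ k ∈ Finset.univ.erase j,
      α * (-(v.im - (w k).im) / ((v.re - (w k).re) ^ 2 + (v.im - (w k).im) ^ 2)) := by
  rw [vecPot, re_ofReal_mul, re_sum, Finset.mul_sum]
  refine Finset.sum_congr rfl fun k hk => ?_
  rw [Function.update_self, Function.update_of_ne (Finset.ne_of_mem_erase hk), term_re]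
  simp

lemma vecPot_im_update (α : ℝ) (w : Fin N → ℂ) (j : Fin N) (v : ℂ) :
    (vecPot α j (Function.update w j v)).im = ∑ k ∈ Finset.univ.erase j,
      α * ((v.re - (w k).re) / ((v.re - (w k).re) ^ 2 + (v.im - (w k).im) ^ 2)) := by
  rw [vecPot, im_ofReal_mul, im_sum, Finset.mul_sum]
  refine Finset.sum_congr rfl fun k hk => ?_
  rw [Function.update_self, Function.update_of_ne (Finset.ne_of_mem_erase hk), term_im]
  simp

/-- Primitive of the vector potential along horizontal lines. -/
def phaseRe (α : ℝ) (w : Fin N → ℂ) (j : Fin N) (b s : ℝ) : ℝ :=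
  ∑ k ∈ Finset.univ.erase j, α * -Real.arctan ((s - (w k).re) / (b - (w k).im))

/-- Primitive of the vector potential along vertical lines. -/
def phaseIm (α : ℝ) (w : Fin N → ℂ) (j : Fin N) (a s : ℝ) : ℝ :=
  ∑ k ∈ Finset.univ.erase j, α * Real.arctan ((s - (w k).im) / (a - (w k).re))

lemma hasDerivAt_arctan_div (r : ℝ) {h : ℝ} (hh : h ≠ 0) (s : ℝ) :
    HasDerivAt (fun s => Real.arctan ((s - r) / h)) (h / ((s - r) ^ 2 + h ^ 2)) s := by
  have h1 : HasDerivAt (fun s : ℝ => (s - r) / h) (1 / h) s :=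
    ((hasDerivAt_id s).sub_const r).div_const h
  convert h1.arctan using 1
  have : (s - r) ^ 2 + h ^ 2 ≠ 0 := by positivity
  have : 1 + ((s - r) / h) ^ 2 ≠ 0 := by positivity
  field_simp
  ring

lemma hasDerivAt_phaseRe (α : ℝ) (w : Fin N → ℂ) (j : Fin N) {b : ℝ}
    (hb : ∀ k, k ≠ j → (w k).im ≠ b) (s : ℝ) :
    HasDerivAt (phaseRe α w j b) (vecPot α j (Function.update w j ⟨s, b⟩)).re s := by
  rw [vecPot_re_update]
  refine HasDerivAt.fun_sum fun k hk => HasDerivAt.const_mul α ?_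
  have hk' : b - (w k).im ≠ 0 := sub_ne_zero.2 (hb k (Finset.ne_of_mem_erase hk)).symm
  rw [neg_div]
  exact (hasDerivAt_arctan_div (w k).re hk' s).fun_neg

lemma hasDerivAt_phaseIm (α : ℝ) (w : Fin N → ℂ) (j : Fin N) {a : ℝ}
    (ha : ∀ k, k ≠ j → (w k).re ≠ a) (s : ℝ) :
    HasDerivAt (phaseIm α w j a) (vecPot α j (Function.update w j ⟨a, s⟩)).im s := by
  rw [vecPot_im_update]
  refine HasDerivAt.fun_sum fun k hk => HasDerivAt.const_mul α ?_
  have hk' : a - (w k).re ≠ 0 := sub_ne_zero.2 (ha k (Finset.ne_of_mem_erase hk)).symm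
  simpa [add_comm] using hasDerivAt_arctan_div (w k).im hk' s

lemma continuous_vecPot_re (α : ℝ) (w : Fin N → ℂ) (j : Fin N) {b : ℝ}
    (hb : ∀ k, k ≠ j → (w k).im ≠ b) :
    Continuous fun s : ℝ => (vecPot α j (Function.update w j ⟨s, b⟩)).re := by
  simp_rw [vecPot_re_update]
  refine continuous_finsetSum _ fun k hk => ?_
  have hk' : b - (w k).im ≠ 0 := sub_ne_zero.2 (hb k (Finset.ne_of_mem_erase hk)).symm
  exact continuous_const.mul (Continuous.div (by fun_prop) (by fun_prop) fun s => by positivity)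

lemma continuous_vecPot_im (α : ℝ) (w : Fin N → ℂ) (j : Fin N) {a : ℝ}
    (ha : ∀ k, k ≠ j → (w k).re ≠ a) :
    Continuous fun s : ℝ => (vecPot α j (Function.update w j ⟨a, s⟩)).im := by
  simp_rw [vecPot_im_update]
  refine continuous_finsetSum _ fun k hk => ?_
  have hk' : a - (w k).re ≠ 0 := sub_ne_zero.2 (ha k (Finset.ne_of_mem_erase hk)).symm
  exact continuous_const.mul (Continuous.div (by fun_prop) (by fun_prop) fun s => by positivity)

lemma transport_horizontal (α : ℝ) (hu : ContDiff ℝ (⊤ : ℕ∞) u) (w : Fin N → ℂ) (j : Fin N)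
    {b : ℝ} (hb : ∀ k, k ≠ j → (w k).im ≠ b) {p ℓ a c : ℝ} (hℓ : 0 < ℓ)
    (ha : a ∈ Icc p (p + ℓ)) (hc : c ∈ Icc p (p + ℓ)) :
    ENNReal.ofReal (‖exp (I * phaseRe α w j b c) * u (Function.update w j ⟨c, b⟩) -
        exp (I * phaseRe α w j b a) * u (Function.update w j ⟨a, b⟩)‖ ^ 2) ≤
      ENNReal.ofReal ℓ * ∫⁻ s in Ioc p (p + ℓ),
        ENNReal.ofReal (‖covRe α u j (Function.update w j ⟨s, b⟩)‖ ^ 2) := by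
  have h := transport_sq (hasDerivAt_line hu w j (b * I) 1) (continuous_deriv_line hu w j _ _)
    (hasDerivAt_phaseRe α w j hb) (continuous_vecPot_re α w j hb) hℓ ha hc
  simp_rw [← mk_eq_horizontal] at h
  exact h

lemma transport_vertical (α : ℝ) (hu : ContDiff ℝ (⊤ : ℕ∞) u) (w : Fin N → ℂ) (j : Fin N)
    {a : ℝ} (ha : ∀ k, k ≠ j → (w k).re ≠ a) {p ℓ b d : ℝ} (hℓ : 0 < ℓ)
    (hb : b ∈ Icc p (p + ℓ)) (hd : d ∈ Icc p (p + ℓ)) :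
    ENNReal.ofReal (‖exp (I * phaseIm α w j a d) * u (Function.update w j ⟨a, d⟩) -
        exp (I * phaseIm α w j a b) * u (Function.update w j ⟨a, b⟩)‖ ^ 2) ≤
      ENNReal.ofReal ℓ * ∫⁻ s in Ioc p (p + ℓ),
        ENNReal.ofReal (‖covIm α u j (Function.update w j ⟨a, s⟩)‖ ^ 2) := by
  have h := transport_sq (hasDerivAt_line hu w j a I) (continuous_deriv_line hu w j _ _)
    (hasDerivAt_phaseIm α w j ha) (continuous_vecPot_im α w j ha) hℓ hb hd
  simp_rw [← mk_eq_vertical] at h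
  exact h

lemma density_horizontal_le (α : ℝ) (hu : ContDiff ℝ (⊤ : ℕ∞) u) (w : Fin N → ℂ) (j : Fin N)
    (b : ℝ) {p ℓ a t : ℝ} (hℓ : 0 < ℓ) (ht : 0 < t) (ha : a ∈ Icc p (p + ℓ)) :
    ENNReal.ofReal (‖u (Function.update w j ⟨a, b⟩)‖ ^ 2) ≤ ∫⁻ s in Ioc p (p + ℓ),
      (ENNReal.ofReal (1 / ℓ + t) * ENNReal.ofReal (‖u (Function.update w j ⟨s, b⟩)‖ ^ 2) +
        ENNReal.ofReal (1 / t) *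
          ENNReal.ofReal (‖covRe α u j (Function.update w j ⟨s, b⟩)‖ ^ 2)) := by
  have h := density_segment_le (hasDerivAt_line hu w j (b * I) 1)
    (continuous_deriv_line hu w j _ _)
    (fun s => (vecPot α j (Function.update w j ⟨s, b⟩)).re) hℓ ht ha
  simp_rw [← mk_eq_horizontal] at h
  exact h

lemma density_vertical_le (α : ℝ) (hu : ContDiff ℝ (⊤ : ℕ∞) u) (w : Fin N → ℂ) (j : Fin N)
    (a : ℝ) {p ℓ b t : ℝ} (hℓ : 0 < ℓ) (ht : 0 < t) (hb : b ∈ Icc p (p + ℓ)) :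
    ENNReal.ofReal (‖u (Function.update w j ⟨a, b⟩)‖ ^ 2) ≤ ∫⁻ s in Ioc p (p + ℓ),
      (ENNReal.ofReal (1 / ℓ + t) * ENNReal.ofReal (‖u (Function.update w j ⟨a, s⟩)‖ ^ 2) +
        ENNReal.ofReal (1 / t) *
          ENNReal.ofReal (‖covIm α u j (Function.update w j ⟨a, s⟩)‖ ^ 2)) := by
  have h := density_segment_le (hasDerivAt_line hu w j a I)
    (continuous_deriv_line hu w j _ _)
    (fun s => (vecPot α j (Function.update w j ⟨a, s⟩)).im) hℓ ht hb
  simp_rw [← mk_eq_vertical] at h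
  exact h

end lines

lemma arctan_div_add_arctan_div {x y : ℝ} (hx : x ≠ 0) (hy : y ≠ 0) :
    Real.arctan (x / y) + Real.arctan (y / x) = Real.pi / 2 * (Real.sign x * Real.sign y) := by
  have hinv : y / x = (x / y)⁻¹ := (inv_div x y).symm
  rw [hinv]
  rcases hx.lt_or_gt with hx | hx <;> rcases hy.lt_or_gt with hy | hy
  · rw [Real.arctan_inv_of_pos (div_pos_of_neg_of_neg hx hy), Real.sign_of_neg hx,
      Real.sign_of_neg hy]
    ring
  · rw [Real.arctan_inv_of_neg (div_neg_of_neg_of_pos hx hy), Real.sign_of_neg hx,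
      Real.sign_of_pos hy]
    ring
  · rw [Real.arctan_inv_of_neg (div_neg_of_pos_of_neg hx hy), Real.sign_of_pos hx,
      Real.sign_of_neg hy]
    ring
  · rw [Real.arctan_inv_of_pos (div_pos hx hy), Real.sign_of_pos hx, Real.sign_of_pos hy]
    ring

/-- Winding of a rectangle with opposite corners `(a, b)` and `(c, d)` around the origin. -/
lemma rectangle_winding {a b c d : ℝ} (ha : a ≠ 0) (hb : b ≠ 0) (hc : c ≠ 0) (hd : d ≠ 0)
    (hac : a ≠ c) (hbd : b ≠ d) :
    ∃ χ : ℕ, χ ≤ 1 ∧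
      -Real.arctan (c / b) - -Real.arctan (a / b) + (-Real.arctan (a / d) - -Real.arctan (c / d))
        + (Real.arctan (d / c) - Real.arctan (b / c)) + (Real.arctan (b / a) - Real.arctan (d / a))
      = Real.pi * (Real.sign (a - c) * Real.sign (b - d)) * (2 * χ) := by
  have h1 := arctan_div_add_arctan_div hc hb
  have h2 := arctan_div_add_arctan_div ha hb
  have h3 := arctan_div_add_arctan_div hc hd
  have h4 := arctan_div_add_arctan_div ha hd
  have h : -Real.arctan (c / b) - -Real.arctan (a / b)
        + (-Real.arctan (a / d) - -Real.arctan (c / d))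
        + (Real.arctan (d / c) - Real.arctan (b / c)) + (Real.arctan (b / a) - Real.arctan (d / a))
      = Real.pi / 2 * ((Real.sign a - Real.sign c) * (Real.sign b - Real.sign d)) := by
    linear_combination -h1 + h2 + h3 - h4
  rw [h]
  have key : ∀ {x y : ℝ}, x ≠ 0 → y ≠ 0 → x ≠ y →
      Real.sign x - Real.sign y = 0 ∨ Real.sign x - Real.sign y = 2 * Real.sign (x - y) := by
    intro x y hx hy hxy
    rcases hx.lt_or_gt with hx | hx <;> rcases hy.lt_or_gt with hy | hy
    · left; rw [Real.sign_of_neg hx, Real.sign_of_neg hy]; ring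
    · right
      rw [Real.sign_of_neg hx, Real.sign_of_pos hy, Real.sign_of_neg (by linarith)]; ring
    · right
      rw [Real.sign_of_pos hx, Real.sign_of_neg hy, Real.sign_of_pos (by linarith)]; ring
    · left; rw [Real.sign_of_pos hx, Real.sign_of_pos hy]; ring
  rcases key ha hc hac with h5 | h5
  · exact ⟨0, zero_le_one, by rw [h5]; simp⟩
  rcases key hb hd hbd with h6 | h6
  · exact ⟨0, zero_le_one, by rw [h6]; simp⟩
  exact ⟨1, le_rfl, by rw [h5, h6]; push_cast; ring⟩

lemma exists_two_mul_abs_le_norm_exp_sub_one (y : ℝ) :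
    ∃ q : ℤ, 2 * |y - 2 * q| ≤ ‖exp (I * (Real.pi * y : ℝ)) - 1‖ := by
  refine ⟨round (y / 2), ?_⟩
  set q := round (y / 2)
  have hq : |y - 2 * q| ≤ 1 := by
    have := abs_sub_round (y / 2)
    rw [abs_le] at this ⊢
    constructor <;> linarith [this.1, this.2]
  have hper : exp (I * (Real.pi * y : ℝ)) = exp (I * (Real.pi * (y - 2 * q) : ℝ)) := by
    rw [exp_eq_exp_iff_exists_int]
    exact ⟨q, by push_cast; ring⟩
  rw [hper, norm_exp_I_mul_ofReal_sub_one, Real.norm_eq_abs, abs_mul, abs_two]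
  set x := y - 2 * q
  have habs : |Real.sin (Real.pi * x / 2)| = |Real.sin (Real.pi * |x| / 2)| := by
    rcases abs_choice x with h | h <;> rw [h]
    rw [mul_neg, neg_div, Real.sin_neg, abs_neg]
  rw [habs]
  have h := Real.mul_le_sin (x := Real.pi * |x| / 2) (by positivity)
    (by nlinarith [Real.pi_pos, abs_nonneg x])
  have h' : 2 / Real.pi * (Real.pi * |x| / 2) = |x| := by field_simp
  rw [h'] at h
  linarith [le_abs_self (Real.sin (Real.pi * |x| / 2))]

lemma statC_le (α : ℝ) {N : ℕ} {p : ℕ} (hp : p < N - 1) (q : ℤ) :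
    statC α N ≤ |(2 * (p : ℝ) + 1) * α - 2 * q| := by
  have hb : ∀ p : Fin (N - 1),
      BddBelow (range fun q : ℤ => |(2 * ((p : ℕ) : ℝ) + 1) * α - 2 * (q : ℝ)|) :=
    fun p => ⟨0, by rintro _ ⟨q, rfl⟩; exact abs_nonneg _⟩
  refine (ciInf_le ⟨0, ?_⟩ (⟨p, hp⟩ : Fin (N - 1))).trans (ciInf_le (hb ⟨p, hp⟩) q)
  rintro _ ⟨p, rfl⟩
  exact le_ciInf fun q => abs_nonneg _

lemma statC_nonneg (α : ℝ) (N : ℕ) : 0 ≤ statC α N :=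
  Real.iInf_nonneg fun _ => Real.iInf_nonneg fun _ => abs_nonneg _

lemma statC_le_one (α : ℝ) {N : ℕ} (hN : 2 ≤ N) : statC α N ≤ 1 := by
  refine (statC_le α (p := 0) (by omega) (round (α / 2))).trans ?_
  have := abs_sub_round (α / 2)
  rw [abs_le] at this ⊢
  constructor <;> push_cast <;> linarith [this.1, this.2]

section exchange

variable {N : ℕ} {u : (Fin N → ℂ) → ℂ}

/-- Holonomy of the exchange of two particles along the sides of a rectangle. -/
lemma exchange_holonomy (α : ℝ) (w : Fin N → ℂ) {j k : Fin N} (hjk : j ≠ k) {a b c d : ℝ}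
    (hac : a ≠ c) (hbd : b ≠ d)
    (hre : ∀ l, (w l).re ≠ a ∧ (w l).re ≠ c) (him : ∀ l, (w l).im ≠ b ∧ (w l).im ≠ d) :
    ∃ p : ℕ, p < N - 1 ∧
      phaseRe α (Function.update w k ⟨c, d⟩) j b c - phaseRe α (Function.update w k ⟨c, d⟩) j b a
      + (phaseRe α (Function.update w j ⟨c, b⟩) k d a
          - phaseRe α (Function.update w j ⟨c, b⟩) k d c)
      + (phaseIm α (Function.update w k ⟨a, d⟩) j c d
          - phaseIm α (Function.update w k ⟨a, d⟩) j c b)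
      + (phaseIm α (Function.update w j ⟨c, d⟩) k a b
          - phaseIm α (Function.update w j ⟨c, d⟩) k a d)
      = Real.pi * ((Real.sign (a - c) * Real.sign (b - d)) * ((2 * (p : ℝ) + 1) * α)) := by
  choose χ hχ1 hχ using fun l => rectangle_winding (sub_ne_zero.2 (hre l).1.symm)
    (sub_ne_zero.2 (him l).1.symm) (sub_ne_zero.2 (hre l).2.symm)
    (sub_ne_zero.2 (him l).2.symm) (fun h => hac (sub_left_injective h))
    (fun h => hbd (sub_left_injective h))
  have hk : k ∈ Finset.univ.erase j := by simp [hjk.symm]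
  have hj : j ∈ Finset.univ.erase k := by simp [hjk]
  set O := (Finset.univ.erase j).erase k with hO
  have hO' : (Finset.univ.erase k).erase j = O := Finset.erase_right_comm
  have hcard : O.card = N - 1 - 1 := by
    rw [hO, Finset.card_erase_of_mem hk, Finset.card_erase_of_mem (Finset.mem_univ _)]
    simp
  have hN : 2 ≤ N := by
    have := j.2; have := k.2; have := Fin.val_ne_of_ne hjk; omega
  have hsum : ∑ l ∈ O, χ l ≤ N - 1 - 1 := by
    rw [← hcard, Finset.card_eq_sum_ones]
    exact Finset.sum_le_sum fun l _ => hχ1 l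
  have hnk : ∀ l ∈ O, l ≠ k := fun l hl => Finset.ne_of_mem_erase hl
  have hnj : ∀ l ∈ O, l ≠ j := fun l hl => Finset.ne_of_mem_erase (Finset.mem_of_mem_erase hl)
  have splitRe : ∀ (z : ℂ) (h s : ℝ), phaseRe α (Function.update w k z) j h s =
      α * -Real.arctan ((s - z.re) / (h - z.im)) +
        ∑ l ∈ O, α * -Real.arctan ((s - (w l).re) / (h - (w l).im)) := fun z h s => by
    rw [phaseRe, ← Finset.add_sum_erase _ _ hk, Function.update_self]
    congr 1
    exact Finset.sum_congr rfl fun l hl => by rw [Function.update_of_ne (hnk l hl)]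
  have splitRe' : ∀ (z : ℂ) (h s : ℝ), phaseRe α (Function.update w j z) k h s =
      α * -Real.arctan ((s - z.re) / (h - z.im)) +
        ∑ l ∈ O, α * -Real.arctan ((s - (w l).re) / (h - (w l).im)) := fun z h s => by
    rw [phaseRe, ← Finset.add_sum_erase _ _ hj, Function.update_self, hO']
    congr 1
    exact Finset.sum_congr rfl fun l hl => by rw [Function.update_of_ne (hnj l hl)]
  have splitIm : ∀ (z : ℂ) (h s : ℝ), phaseIm α (Function.update w k z) j h s =
      α * Real.arctan ((s - z.im) / (h - z.re)) +
        ∑ l ∈ O, α * Real.arctan ((s - (w l).im) / (h - (w l).re)) := fun z h s => by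
    rw [phaseIm, ← Finset.add_sum_erase _ _ hk, Function.update_self]
    congr 1
    exact Finset.sum_congr rfl fun l hl => by rw [Function.update_of_ne (hnk l hl)]
  have splitIm' : ∀ (z : ℂ) (h s : ℝ), phaseIm α (Function.update w j z) k h s =
      α * Real.arctan ((s - z.im) / (h - z.re)) +
        ∑ l ∈ O, α * Real.arctan ((s - (w l).im) / (h - (w l).re)) := fun z h s => by
    rw [phaseIm, ← Finset.add_sum_erase _ _ hj, Function.update_self, hO']
    congr 1
    exact Finset.sum_congr rfl fun l hl => by rw [Function.update_of_ne (hnj l hl)]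
  refine ⟨∑ l ∈ O, χ l, by omega, ?_⟩
  have hpair := arctan_div_add_arctan_div (sub_ne_zero.2 hac) (sub_ne_zero.2 hbd)
  have hflip1 : (a - c) / (d - b) = -((a - c) / (b - d)) := by rw [← neg_sub b d, div_neg]
  have hflip2 : (b - d) / (c - a) = -((b - d) / (a - c)) := by rw [← neg_sub a c, div_neg]
  have hothers : ∑ l ∈ O, α * -Real.arctan ((c - (w l).re) / (b - (w l).im))
      - ∑ l ∈ O, α * -Real.arctan ((a - (w l).re) / (b - (w l).im))
      + (∑ l ∈ O, α * -Real.arctan ((a - (w l).re) / (d - (w l).im))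
      - ∑ l ∈ O, α * -Real.arctan ((c - (w l).re) / (d - (w l).im)))
      + (∑ l ∈ O, α * Real.arctan ((d - (w l).im) / (c - (w l).re))
      - ∑ l ∈ O, α * Real.arctan ((b - (w l).im) / (c - (w l).re)))
      + (∑ l ∈ O, α * Real.arctan ((b - (w l).im) / (a - (w l).re))
      - ∑ l ∈ O, α * Real.arctan ((d - (w l).im) / (a - (w l).re)))
      = Real.pi * ((Real.sign (a - c) * Real.sign (b - d))
        * (2 * ((∑ l ∈ O, χ l : ℕ) : ℝ) * α)) := by
    simp only [← Finset.sum_sub_distrib, ← Finset.sum_add_distrib]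
    push_cast
    rw [Finset.mul_sum, Finset.sum_mul, Finset.mul_sum, Finset.mul_sum]
    refine Finset.sum_congr rfl fun l _ => ?_
    have := hχ l
    simp only [sub_sub_sub_cancel_right] at this
    linear_combination α * this
  simp only [splitRe, splitRe', splitIm, splitIm', sub_self, zero_div, Real.arctan_zero,
    hflip1, hflip2, Real.arctan_neg]
  linear_combination hothers + 2 * α * hpair

/-- Exchanging two particles along a rectangle costs kinetic energy. -/
lemma exchange_bound (α : ℝ) (hu : IsAnyonWF N u) (w : Fin N → ℂ) {j k : Fin N} (hjk : j ≠ k)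
    {p q ℓ a b c d : ℝ} (hℓ : 0 < ℓ) (ha : a ∈ Icc p (p + ℓ)) (hc : c ∈ Icc p (p + ℓ))
    (hb : b ∈ Icc q (q + ℓ)) (hd : d ∈ Icc q (q + ℓ)) (hac : a ≠ c) (hbd : b ≠ d)
    (hre : ∀ l, (w l).re ≠ a ∧ (w l).re ≠ c) (him : ∀ l, (w l).im ≠ b ∧ (w l).im ≠ d) :
    ENNReal.ofReal (statC α N ^ 2) *
      ENNReal.ofReal (‖u (Function.update (Function.update w k ⟨c, d⟩) j ⟨a, b⟩)‖ ^ 2) ≤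
    ENNReal.ofReal ℓ *
      ((∫⁻ s in Ioc p (p + ℓ), ENNReal.ofReal
        (‖covRe α u j (Function.update (Function.update w k ⟨c, d⟩) j ⟨s, b⟩)‖ ^ 2)) +
      (∫⁻ s in Ioc p (p + ℓ), ENNReal.ofReal
        (‖covRe α u k (Function.update (Function.update w k ⟨s, d⟩) j ⟨c, b⟩)‖ ^ 2)) +
      (∫⁻ s in Ioc q (q + ℓ), ENNReal.ofReal
        (‖covIm α u j (Function.update (Function.update w k ⟨a, d⟩) j ⟨c, s⟩)‖ ^ 2)) +
      (∫⁻ s in Ioc q (q + ℓ), ENNReal.ofReal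
        (‖covIm α u k (Function.update (Function.update w k ⟨a, s⟩) j ⟨c, d⟩)‖ ^ 2))) := by
  obtain ⟨m, hm, hΦ⟩ := exchange_holonomy α w hjk hac hbd hre him
  have hcond : ∀ {i : Fin N} {z : ℂ} {P : ℂ → Prop}, (∀ l, P (w l)) → P z →
      ∀ l, P (Function.update w i z l) := by
    intro i z P hP hz l
    rcases eq_or_ne l i with rfl | hl
    · rwa [Function.update_self]
    · rw [Function.update_of_ne hl]; exact hP l
  have t1 := transport_horizontal α hu.smooth (Function.update w k ⟨c, d⟩) j (b := b)
    (fun l _ => hcond (P := fun z => z.im ≠ b) (fun l => (him l).1) hbd.symm l) hℓ ha hc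
  have t2 := transport_horizontal α hu.smooth (Function.update w j ⟨c, b⟩) k (b := d)
    (fun l _ => hcond (P := fun z => z.im ≠ d) (fun l => (him l).2) hbd l) hℓ hc ha
  have t3 := transport_vertical α hu.smooth (Function.update w k ⟨a, d⟩) j (a := c)
    (fun l _ => hcond (P := fun z => z.re ≠ c) (fun l => (hre l).2) hac l) hℓ hb hd
  have t4 := transport_vertical α hu.smooth (Function.update w j ⟨c, d⟩) k (a := a)
    (fun l _ => hcond (P := fun z => z.re ≠ a) (fun l => (hre l).1) hac.symm l) hℓ hd hb
  have hcomm : ∀ x y : ℂ, Function.update (Function.update w j x) k y =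
      Function.update (Function.update w k y) j x := fun x y => Function.update_comm hjk x y w
  simp only [hcomm] at t2 t4
  set U0 := u (Function.update (Function.update w k ⟨c, d⟩) j ⟨a, b⟩) with hU0
  set U1 := u (Function.update (Function.update w k ⟨c, d⟩) j ⟨c, b⟩)
  set U2 := u (Function.update (Function.update w k ⟨a, d⟩) j ⟨c, b⟩)
  set U3 := u (Function.update (Function.update w k ⟨a, d⟩) j ⟨c, d⟩)
  have hU4 : u (Function.update (Function.update w k ⟨a, b⟩) j ⟨c, d⟩) = U0 := by
    rw [hU0, ← hu.symmetric (Equiv.swap j k)]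
    congr 1
    ext l
    simp only [Function.comp]
    rcases eq_or_ne l j with rfl | hlj
    · simp [hjk.symm]
    rcases eq_or_ne l k with rfl | hlk
    · simp [hjk.symm]
    · rw [Equiv.swap_apply_of_ne_of_ne hlj hlk]
      simp [hlj, hlk]
  rw [hU4] at t4
  set θ1 := phaseRe α (Function.update w k ⟨c, d⟩) j b
  set θ2 := phaseRe α (Function.update w j ⟨c, b⟩) k d
  set θ3 := phaseIm α (Function.update w k ⟨a, d⟩) j c
  set θ4 := phaseIm α (Function.update w j ⟨c, d⟩) k a
  have hnorm : ∀ (s t : ℝ) (X Y : ℂ),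
      ‖exp (I * s) * X - exp (I * t) * Y‖ = ‖exp (I * ((s - t : ℝ) : ℂ)) * X - Y‖ := by
    intro s t X Y
    have : exp (I * s) * X - exp (I * t) * Y =
        exp (t * I) * (exp (I * ((s - t : ℝ) : ℂ)) * X - Y) := by
      rw [mul_sub, ← mul_assoc, ← Complex.exp_add]
      congr 3
      · push_cast; ring_nf
      · ring_nf
    rw [this, norm_mul, norm_exp_ofReal_mul_I, one_mul]
  rw [hnorm] at t1 t2 t3 t4
  set r1 := ‖exp (I * ((θ1 c - θ1 a : ℝ) : ℂ)) * U1 - U0‖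
  set r2 := ‖exp (I * ((θ2 a - θ2 c : ℝ) : ℂ)) * U2 - U1‖
  set r3 := ‖exp (I * ((θ3 d - θ3 b : ℝ) : ℂ)) * U3 - U2‖
  set r4 := ‖exp (I * ((θ4 b - θ4 d : ℝ) : ℂ)) * U0 - U3‖
  have hstep : ∀ (φ ψ : ℝ) (X Y Z : ℂ), ‖exp (I * ((φ + ψ : ℝ) : ℂ)) * Z - X‖ ≤
      ‖exp (I * (φ : ℂ)) * Y - X‖ + ‖exp (I * (ψ : ℂ)) * Z - Y‖ := by
    intro φ ψ X Y Z
    have : exp (I * ((φ + ψ : ℝ) : ℂ)) * Z - X =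
        (exp (I * (φ : ℂ)) * Y - X) + exp (φ * I) * (exp (I * (ψ : ℂ)) * Z - Y) := by
      rw [mul_comm (φ : ℂ) I]
      push_cast
      rw [mul_add, Complex.exp_add]
      ring
    rw [this]
    refine (norm_add_le _ _).trans (le_of_eq ?_)
    rw [norm_mul, norm_exp_ofReal_mul_I, one_mul]
  have htot : ‖exp (I * ((θ1 c - θ1 a + (θ2 a - θ2 c) + (θ3 d - θ3 b) + (θ4 b - θ4 d) : ℝ) : ℂ))
      * U0 - U0‖ ≤ r1 + r2 + r3 + r4 := by
    refine (hstep _ _ _ U3 _).trans (add_le_add_left ?_ _)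
    refine (hstep _ _ _ U2 _).trans (add_le_add_left ?_ _)
    exact hstep _ _ _ U1 _
  rw [hΦ] at htot
  have hlow : 2 * statC α N * ‖U0‖ ≤ r1 + r2 + r3 + r4 := by
    refine le_trans ?_ htot
    obtain ⟨n, hn⟩ := exists_two_mul_abs_le_norm_exp_sub_one
      (Real.sign (a - c) * Real.sign (b - d) * ((2 * (m : ℝ) + 1) * α))
    rw [← sub_one_mul, norm_mul]
    refine mul_le_mul_of_nonneg_right (le_trans ?_ hn) (norm_nonneg _)
    have hsign : Real.sign (a - c) * Real.sign (b - d) = 1 ∨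
        Real.sign (a - c) * Real.sign (b - d) = -1 := by
      rcases Real.sign_apply_eq_of_ne_zero _ (sub_ne_zero.2 hac) with h | h <;>
      rcases Real.sign_apply_eq_of_ne_zero _ (sub_ne_zero.2 hbd) with h' | h' <;>
      simp [h, h']
    rcases hsign with h | h
    · rw [h, one_mul]
      linarith [statC_le α hm n]
    · have := statC_le α hm (-n)
      rw [h, neg_one_mul, ← abs_neg]
      push_cast at this
      have e : -(-((2 * (m : ℝ) + 1) * α) - 2 * n) = (2 * (m : ℝ) + 1) * α - 2 * -n := by ring
      rw [e]
      linarith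
  have hsq : statC α N ^ 2 * ‖U0‖ ^ 2 ≤ r1 ^ 2 + r2 ^ 2 + r3 ^ 2 + r4 ^ 2 := by
    have h1 := pow_le_pow_left₀ (by have := statC_nonneg α N; positivity) hlow 2
    nlinarith [sq_nonneg (r1 - r2), sq_nonneg (r1 - r3), sq_nonneg (r1 - r4),
      sq_nonneg (r2 - r3), sq_nonneg (r2 - r4), sq_nonneg (r3 - r4)]
  rw [← ENNReal.ofReal_mul (sq_nonneg _)]
  refine (ENNReal.ofReal_le_ofReal hsq).trans ?_
  rw [ENNReal.ofReal_add (by positivity) (by positivity),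
    ENNReal.ofReal_add (by positivity) (by positivity),
    ENNReal.ofReal_add (by positivity) (by positivity), mul_add, mul_add, mul_add]
  exact add_le_add (add_le_add (add_le_add t1 t2) t3) t4

end exchange

/-- Joint measurability of a function of four real variables. -/
def Measurable₄ (G : ℝ → ℝ → ℝ → ℝ → ℝ≥0∞) : Prop :=
  Measurable fun z : ℝ × ℝ × ℝ × ℝ => G z.1 z.2.1 z.2.2.1 z.2.2.2

lemma lintegral₄_swap₃₄ {m₁ m₂ m₃ m₄ : Measure ℝ} [SFinite m₃] [SFinite m₄]
    {G : ℝ → ℝ → ℝ → ℝ → ℝ≥0∞} (hG : Measurable₄ G) :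
    ∫⁻ a, ∫⁻ b, ∫⁻ c, ∫⁻ d, G a b c d ∂m₄ ∂m₃ ∂m₂ ∂m₁ =
      ∫⁻ a, ∫⁻ b, ∫⁻ d, ∫⁻ c, G a b c d ∂m₃ ∂m₄ ∂m₂ ∂m₁ := by
  refine lintegral_congr fun a => lintegral_congr fun b => lintegral_lintegral_swap ?_
  exact (hG.comp (f := fun z : ℝ × ℝ => (a, b, z.1, z.2)) (by fun_prop)).aemeasurable

lemma lintegral₄_swap₂₃ {m₁ m₂ m₃ m₄ : Measure ℝ} [SFinite m₂] [SFinite m₃] [SFinite m₄]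
    {G : ℝ → ℝ → ℝ → ℝ → ℝ≥0∞} (hG : Measurable₄ G) :
    ∫⁻ a, ∫⁻ b, ∫⁻ c, ∫⁻ d, G a b c d ∂m₄ ∂m₃ ∂m₂ ∂m₁ =
      ∫⁻ a, ∫⁻ c, ∫⁻ b, ∫⁻ d, G a b c d ∂m₄ ∂m₂ ∂m₃ ∂m₁ := by
  refine lintegral_congr fun a => lintegral_lintegral_swap ?_
  exact (Measurable.lintegral_prod_right' (f := fun z : (ℝ × ℝ) × ℝ => G a z.1.1 z.1.2 z.2)
    (hG.comp (f := fun z : (ℝ × ℝ) × ℝ => (a, z.1.1, z.1.2, z.2)) (by fun_prop))).aemeasurable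

lemma lintegral₄_swap₁₂ {m₁ m₂ m₃ m₄ : Measure ℝ} [SFinite m₁] [SFinite m₂] [SFinite m₃] [SFinite m₄]
    {G : ℝ → ℝ → ℝ → ℝ → ℝ≥0∞} (hG : Measurable₄ G) :
    ∫⁻ a, ∫⁻ b, ∫⁻ c, ∫⁻ d, G a b c d ∂m₄ ∂m₃ ∂m₂ ∂m₁ =
      ∫⁻ b, ∫⁻ a, ∫⁻ c, ∫⁻ d, G a b c d ∂m₄ ∂m₃ ∂m₁ ∂m₂ := by
  refine lintegral_lintegral_swap ?_
  have h1 := Measurable.lintegral_prod_right' (ν := m₄)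
    (f := fun z : ((ℝ × ℝ) × ℝ) × ℝ => G z.1.1.1 z.1.1.2 z.1.2 z.2)
    (hG.comp (f := fun z : ((ℝ × ℝ) × ℝ) × ℝ => (z.1.1.1, z.1.1.2, z.1.2, z.2)) (by fun_prop))
  exact (Measurable.lintegral_prod_right' (ν := m₃) h1).aemeasurable

lemma Measurable₄.iterated {m₂ m₃ m₄ : Measure ℝ} [SFinite m₂] [SFinite m₃] [SFinite m₄]
    {K : ℝ → ℝ → ℝ → ℝ → ℝ≥0∞} (hK : Measurable₄ K) :
    (∀ c d a, Measurable fun b => K c d a b) ∧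
    (∀ c d, Measurable fun a => ∫⁻ b, K c d a b ∂m₄) ∧
    (∀ c, Measurable fun d => ∫⁻ a, ∫⁻ b, K c d a b ∂m₄ ∂m₃) ∧
    Measurable fun c => ∫⁻ d, ∫⁻ a, ∫⁻ b, K c d a b ∂m₄ ∂m₃ ∂m₂ := by
  have hm' : ∀ {β : Type} [MeasurableSpace β] {m : Measure ℝ} [SFinite m] {K : β → ℝ → ℝ≥0∞},
      Measurable (Function.uncurry K) → Measurable fun z => ∫⁻ s, K z s ∂m :=
    fun {β} _ m _ K hK => Measurable.lintegral_prod_right' hK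
  refine ⟨fun c d a => ?_, fun c d => ?_, fun c => ?_, ?_⟩
  · exact hK.comp (f := fun b : ℝ => (c, d, a, b)) (by fun_prop)
  · exact hm' (hK.comp (f := fun z : ℝ × ℝ => (c, d, z.1, z.2)) (by fun_prop))
  · exact hm' (K := fun d a => ∫⁻ b, K c d a b ∂m₄)
      (hm' (K := fun z : ℝ × ℝ => fun b => K c z.1 z.2 b)
      (hK.comp (f := fun z : (ℝ × ℝ) × ℝ => (c, z.1.1, z.1.2, z.2)) (by fun_prop)))
  · exact hm' (K := fun c d => ∫⁻ a, ∫⁻ b, K c d a b ∂m₄ ∂m₃)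
      (hm' (K := fun z : ℝ × ℝ => fun a => ∫⁻ b, K z.1 z.2 a b ∂m₄)
      (hm' (K := fun z : (ℝ × ℝ) × ℝ => fun b => K z.1.1 z.1.2 z.2 b)
      (hK.comp (f := fun z : ((ℝ × ℝ) × ℝ) × ℝ => (z.1.1.1, z.1.1.2, z.1.2, z.2))
        (by fun_prop))))

/-- The half-open square with lower left corner `(p, q)` and side length `ℓ`. -/
def cell (p q ℓ : ℝ) : Set ℂ := Ioc p (p + ℓ) ×ℂ Ioc q (q + ℓ)

lemma measurableSet_cell (p q ℓ : ℝ) : MeasurableSet (cell p q ℓ) :=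
  (measurableSet_Ioc.preimage measurable_re).inter (measurableSet_Ioc.preimage measurable_im)

lemma measurable_mk : Measurable fun z : ℝ × ℝ => (⟨z.1, z.2⟩ : ℂ) :=
  measurableEquivRealProd.symm.measurable

lemma setLIntegral_reProdIm {f : ℂ → ℝ≥0∞} (hf : Measurable f) {S T : Set ℝ} :
    ∫⁻ v in S ×ℂ T, f v = ∫⁻ a in S, ∫⁻ b in T, f ⟨a, b⟩ := by
  have h := volume_preserving_equiv_real_prod.symm.setLIntegral_comp_preimage_emb
    measurableEquivRealProd.symm.measurableEmbedding f (S ×ℂ T)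
  rw [← h]
  have hpre : measurableEquivRealProd.symm ⁻¹' (S ×ℂ T) = S ×ˢ T := rfl
  rw [hpre, Measure.volume_eq_prod, ← Measure.prod_restrict,
    lintegral_prod _ (by exact (hf.comp measurable_mk).aemeasurable)]
  rfl

lemma setLIntegral_cell {f : ℂ → ℝ≥0∞} (hf : Measurable f) (p q ℓ : ℝ) :
    ∫⁻ v in cell p q ℓ, f v = ∫⁻ a in Ioc p (p + ℓ), ∫⁻ b in Ioc q (q + ℓ), f ⟨a, b⟩ :=
  setLIntegral_reProdIm hf

lemma setLIntegral_cell_cell {F : ℂ → ℂ → ℝ≥0∞} (hF : Measurable (Function.uncurry F))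
    (p q ℓ : ℝ) :
    ∫⁻ y in cell p q ℓ, ∫⁻ v in cell p q ℓ, F v y =
      ∫⁻ c in Ioc p (p + ℓ), ∫⁻ d in Ioc q (q + ℓ), ∫⁻ a in Ioc p (p + ℓ),
        ∫⁻ b in Ioc q (q + ℓ), F ⟨a, b⟩ ⟨c, d⟩ := by
  rw [setLIntegral_cell]
  · refine lintegral_congr fun c => lintegral_congr fun d => ?_
    rw [setLIntegral_cell]
    exact hF.comp (measurable_id.prodMk measurable_const)
  · exact Measurable.lintegral_prod_right' (f := fun z : ℂ × ℂ => F z.2 z.1)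
      (hF.comp measurable_swap)

/-- Integrated form of the exchange estimate on a product of two identical squares. -/
lemma two_body_integrate {F G₁ G₂ G₃ G₄ : ℂ → ℂ → ℝ≥0∞}
    (hF : Measurable (Function.uncurry F)) (h₁ : Measurable (Function.uncurry G₁))
    (h₂ : Measurable (Function.uncurry G₂)) (h₃ : Measurable (Function.uncurry G₃))
    (h₄ : Measurable (Function.uncurry G₄)) (κ : ℝ≥0∞) {p q ℓ : ℝ}
    {S : Set ℝ} (hS : S.Countable)
    (h : ∀ a ∈ Ioc p (p + ℓ), ∀ b ∈ Ioc q (q + ℓ), ∀ c ∈ Ioc p (p + ℓ), ∀ d ∈ Ioc q (q + ℓ),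
      a ∉ S → b ∉ S → c ∉ S → d ∉ S → a ≠ c → b ≠ d →
      F ⟨a, b⟩ ⟨c, d⟩ ≤ κ * ((∫⁻ s in Ioc p (p + ℓ), G₁ ⟨s, b⟩ ⟨c, d⟩) +
        (∫⁻ s in Ioc p (p + ℓ), G₂ ⟨c, b⟩ ⟨s, d⟩) +
        (∫⁻ s in Ioc q (q + ℓ), G₃ ⟨c, s⟩ ⟨a, d⟩) +
        (∫⁻ s in Ioc q (q + ℓ), G₄ ⟨c, d⟩ ⟨a, s⟩))) :
    ∫⁻ y in cell p q ℓ, ∫⁻ v in cell p q ℓ, F v y ≤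
      κ * ENNReal.ofReal ℓ * ∫⁻ y in cell p q ℓ, ∫⁻ v in cell p q ℓ,
        (G₁ v y + G₂ v y + G₃ v y + G₄ v y) := by
  set μ := (volume : Measure ℝ).restrict (Ioc p (p + ℓ)) with hμ
  set ν := (volume : Measure ℝ).restrict (Ioc q (q + ℓ)) with hν
  have hμ1 : μ univ = ENNReal.ofReal ℓ := by simp [hμ]
  have hν1 : ν univ = ENNReal.ofReal ℓ := by simp [hν]
  have hmk : ∀ {G : ℂ → ℂ → ℝ≥0∞}, Measurable (Function.uncurry G) →
      ∀ {β : Type} [MeasurableSpace β] {a b c d : β → ℝ}, Measurable a → Measurable b →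
      Measurable c → Measurable d →
      Measurable fun z => G ⟨a z, b z⟩ ⟨c z, d z⟩ := by
    intro G hG β _ a b c d ha hb hc hd
    exact hG.comp ((measurable_mk.comp (ha.prodMk hb)).prodMk (measurable_mk.comp (hc.prodMk hd)))
  have e₁ : ∫⁻ c, ∫⁻ d, ∫⁻ a, ∫⁻ b, ∫⁻ s, G₁ ⟨s, b⟩ ⟨c, d⟩ ∂μ ∂ν ∂μ ∂ν ∂μ =
      ENNReal.ofReal ℓ * ∫⁻ y in cell p q ℓ, ∫⁻ v in cell p q ℓ, G₁ v y := by
    rw [setLIntegral_cell_cell h₁, ← hμ, ← hν]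
    simp_rw [lintegral_const, hμ1]
    simp_rw [lintegral_mul_const' _ _ ENNReal.ofReal_ne_top]
    rw [mul_comm]
    congr 1
    exact lintegral₄_swap₃₄ (G := fun c d b s => G₁ ⟨s, b⟩ ⟨c, d⟩)
      (hmk h₁ (by fun_prop) (by fun_prop) (by fun_prop) (by fun_prop))
  have e₂ : ∫⁻ c, ∫⁻ d, ∫⁻ a, ∫⁻ b, ∫⁻ s, G₂ ⟨c, b⟩ ⟨s, d⟩ ∂μ ∂ν ∂μ ∂ν ∂μ =
      ENNReal.ofReal ℓ * ∫⁻ y in cell p q ℓ, ∫⁻ v in cell p q ℓ, G₂ v y := by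
    rw [setLIntegral_cell_cell h₂, ← hμ, ← hν]
    simp_rw [lintegral_const, hμ1]
    simp_rw [lintegral_mul_const' _ _ ENNReal.ofReal_ne_top]
    rw [mul_comm]
    congr 1
    refine (lintegral₄_swap₃₄ (G := fun c d b s => G₂ ⟨c, b⟩ ⟨s, d⟩)
      (hmk h₂ (by fun_prop) (by fun_prop) (by fun_prop) (by fun_prop))).trans ?_
    refine (lintegral₄_swap₂₃ (G := fun c d s b => G₂ ⟨c, b⟩ ⟨s, d⟩)
      (hmk h₂ (by fun_prop) (by fun_prop) (by fun_prop) (by fun_prop))).trans ?_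
    refine (lintegral₄_swap₁₂ (G := fun c s d b => G₂ ⟨c, b⟩ ⟨s, d⟩)
      (hmk h₂ (by fun_prop) (by fun_prop) (by fun_prop) (by fun_prop))).trans ?_
    exact lintegral₄_swap₂₃ (G := fun s c d b => G₂ ⟨c, b⟩ ⟨s, d⟩)
      (hmk h₂ (by fun_prop) (by fun_prop) (by fun_prop) (by fun_prop))
  have e₃ : ∫⁻ c, ∫⁻ d, ∫⁻ a, ∫⁻ b, ∫⁻ s, G₃ ⟨c, s⟩ ⟨a, d⟩ ∂ν ∂ν ∂μ ∂ν ∂μ =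
      ENNReal.ofReal ℓ * ∫⁻ y in cell p q ℓ, ∫⁻ v in cell p q ℓ, G₃ v y := by
    rw [setLIntegral_cell_cell h₃, ← hμ, ← hν]
    simp_rw [lintegral_const, hν1]
    simp_rw [lintegral_mul_const' _ _ ENNReal.ofReal_ne_top]
    rw [mul_comm]
    congr 1
    refine (lintegral₄_swap₂₃ (G := fun c d a s => G₃ ⟨c, s⟩ ⟨a, d⟩)
      (hmk h₃ (by fun_prop) (by fun_prop) (by fun_prop) (by fun_prop))).trans ?_
    refine (lintegral₄_swap₁₂ (G := fun c a d s => G₃ ⟨c, s⟩ ⟨a, d⟩)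
      (hmk h₃ (by fun_prop) (by fun_prop) (by fun_prop) (by fun_prop))).trans ?_
    exact lintegral₄_swap₂₃ (G := fun a c d s => G₃ ⟨c, s⟩ ⟨a, d⟩)
      (hmk h₃ (by fun_prop) (by fun_prop) (by fun_prop) (by fun_prop))
  have e₄ : ∫⁻ c, ∫⁻ d, ∫⁻ a, ∫⁻ b, ∫⁻ s, G₄ ⟨c, d⟩ ⟨a, s⟩ ∂ν ∂ν ∂μ ∂ν ∂μ =
      ENNReal.ofReal ℓ * ∫⁻ y in cell p q ℓ, ∫⁻ v in cell p q ℓ, G₄ v y := by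
    rw [setLIntegral_cell_cell h₄, ← hμ, ← hν]
    simp_rw [lintegral_const, hν1]
    simp_rw [lintegral_mul_const' _ _ ENNReal.ofReal_ne_top]
    rw [mul_comm]
    congr 1
    refine (lintegral₄_swap₂₃ (G := fun c d a s => G₄ ⟨c, d⟩ ⟨a, s⟩)
      (hmk h₄ (by fun_prop) (by fun_prop) (by fun_prop) (by fun_prop))).trans ?_
    refine (lintegral₄_swap₁₂ (G := fun c a d s => G₄ ⟨c, d⟩ ⟨a, s⟩)
      (hmk h₄ (by fun_prop) (by fun_prop) (by fun_prop) (by fun_prop))).trans ?_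
    refine (lintegral₄_swap₃₄ (G := fun a c d s => G₄ ⟨c, d⟩ ⟨a, s⟩)
      (hmk h₄ (by fun_prop) (by fun_prop) (by fun_prop) (by fun_prop))).trans ?_
    exact lintegral₄_swap₂₃ (G := fun a c s d => G₄ ⟨c, d⟩ ⟨a, s⟩)
      (hmk h₄ (by fun_prop) (by fun_prop) (by fun_prop) (by fun_prop))
  have hbound : ∫⁻ y in cell p q ℓ, ∫⁻ v in cell p q ℓ, F v y ≤
      ∫⁻ c, ∫⁻ d, ∫⁻ a, ∫⁻ b, κ * ((∫⁻ s, G₁ ⟨s, b⟩ ⟨c, d⟩ ∂μ) + (∫⁻ s, G₂ ⟨c, b⟩ ⟨s, d⟩ ∂μ) +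
        (∫⁻ s, G₃ ⟨c, s⟩ ⟨a, d⟩ ∂ν) + (∫⁻ s, G₄ ⟨c, d⟩ ⟨a, s⟩ ∂ν)) ∂ν ∂μ ∂ν ∂μ := by
    rw [setLIntegral_cell_cell hF]
    have hS' : ∀ᵐ a : ℝ, a ∉ S := hS.ae_notMem volume
    have hne : ∀ r : ℝ, ∀ᵐ a : ℝ, a ∉ ({r} : Set ℝ) := fun r =>
      (countable_singleton r).ae_notMem volume
    refine lintegral_mono_ae ?_
    filter_upwards [ae_restrict_mem measurableSet_Ioc, ae_restrict_of_ae hS'] with c hc hc'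
    refine lintegral_mono_ae ?_
    filter_upwards [ae_restrict_mem measurableSet_Ioc, ae_restrict_of_ae hS'] with d hd hd'
    refine lintegral_mono_ae ?_
    filter_upwards [ae_restrict_mem measurableSet_Ioc, ae_restrict_of_ae hS',
      ae_restrict_of_ae (hne c)] with a ha ha' hac
    refine lintegral_mono_ae ?_
    filter_upwards [ae_restrict_mem measurableSet_Ioc, ae_restrict_of_ae hS',
      ae_restrict_of_ae (hne d)] with b hb hb' hbd
    exact h a ha b hb c hc d hd ha' hb' hc' hd' hac hbd
  refine hbound.trans (le_of_eq ?_)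
  have hM : ∀ {G : ℂ → ℂ → ℝ≥0∞}, Measurable (Function.uncurry G) →
      Measurable fun y => ∫⁻ v in cell p q ℓ, G v y := fun {G} hG =>
    Measurable.lintegral_prod_right' (f := fun z : ℂ × ℂ => G z.2 z.1) (hG.comp measurable_swap)
  have hm : ∀ {G : ℂ → ℂ → ℝ≥0∞}, Measurable (Function.uncurry G) → ∀ y,
      Measurable fun v => G v y := fun {G} hG y => hG.comp (measurable_id.prodMk measurable_const)
  have hm' : ∀ {β : Type} [MeasurableSpace β] {m : Measure ℝ} [SFinite m] {K : β → ℝ → ℝ≥0∞},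
      Measurable (Function.uncurry K) → Measurable fun z => ∫⁻ s, K z s ∂m :=
    fun {β} _ m _ K hK => Measurable.lintegral_prod_right' hK
  have split : ∀ K₁ K₂ : ℝ → ℝ → ℝ → ℝ → ℝ≥0∞, Measurable₄ K₁ →
      ∫⁻ c, ∫⁻ d, ∫⁻ a, ∫⁻ b, (K₁ c d a b + K₂ c d a b) ∂ν ∂μ ∂ν ∂μ =
      ∫⁻ c, ∫⁻ d, ∫⁻ a, ∫⁻ b, K₁ c d a b ∂ν ∂μ ∂ν ∂μ +
        ∫⁻ c, ∫⁻ d, ∫⁻ a, ∫⁻ b, K₂ c d a b ∂ν ∂μ ∂ν ∂μ := by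
    intro K₁ K₂ hK
    obtain ⟨k4, k3, k2, k1⟩ := hK.iterated (m₂ := ν) (m₃ := μ) (m₄ := ν)
    rw [← lintegral_add_left k1]
    refine lintegral_congr fun c => ?_
    rw [← lintegral_add_left (k2 c)]
    refine lintegral_congr fun d => ?_
    rw [← lintegral_add_left (k3 c d)]
    refine lintegral_congr fun a => ?_
    rw [← lintegral_add_left (k4 c d a)]
  have q₁ : Measurable₄ fun c d _ b => ∫⁻ s, G₁ ⟨s, b⟩ ⟨c, d⟩ ∂μ :=
    hm' (hmk h₁ (by fun_prop) (by fun_prop) (by fun_prop) (by fun_prop))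
  have q₂ : Measurable₄ fun c d _ b => ∫⁻ s, G₂ ⟨c, b⟩ ⟨s, d⟩ ∂μ :=
    hm' (hmk h₂ (by fun_prop) (by fun_prop) (by fun_prop) (by fun_prop))
  have q₃ : Measurable₄ fun c d a _ => ∫⁻ s, G₃ ⟨c, s⟩ ⟨a, d⟩ ∂ν :=
    hm' (hmk h₃ (by fun_prop) (by fun_prop) (by fun_prop) (by fun_prop))
  have q₄ : Measurable₄ fun c d a _ => ∫⁻ s, G₄ ⟨c, d⟩ ⟨a, s⟩ ∂ν :=
    hm' (hmk h₄ (by fun_prop) (by fun_prop) (by fun_prop) (by fun_prop))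
  have q₁₂ : Measurable₄ fun c d _ b => (∫⁻ s, G₁ ⟨s, b⟩ ⟨c, d⟩ ∂μ) + ∫⁻ s, G₂ ⟨c, b⟩ ⟨s, d⟩ ∂μ :=
    Measurable.add q₁ q₂
  have q₁₂₃ : Measurable₄ fun c d a b => (∫⁻ s, G₁ ⟨s, b⟩ ⟨c, d⟩ ∂μ) +
      (∫⁻ s, G₂ ⟨c, b⟩ ⟨s, d⟩ ∂μ) + ∫⁻ s, G₃ ⟨c, s⟩ ⟨a, d⟩ ∂ν :=
    Measurable.add q₁₂ q₃
  have q : Measurable₄ fun c d a b => (∫⁻ s, G₁ ⟨s, b⟩ ⟨c, d⟩ ∂μ) +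
      (∫⁻ s, G₂ ⟨c, b⟩ ⟨s, d⟩ ∂μ) + (∫⁻ s, G₃ ⟨c, s⟩ ⟨a, d⟩ ∂ν) + ∫⁻ s, G₄ ⟨c, d⟩ ⟨a, s⟩ ∂ν :=
    Measurable.add q₁₂₃ q₄
  have pull : ∀ K : ℝ → ℝ → ℝ → ℝ → ℝ≥0∞, Measurable₄ K →
      ∫⁻ c, ∫⁻ d, ∫⁻ a, ∫⁻ b, κ * K c d a b ∂ν ∂μ ∂ν ∂μ =
      κ * ∫⁻ c, ∫⁻ d, ∫⁻ a, ∫⁻ b, K c d a b ∂ν ∂μ ∂ν ∂μ := by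
    intro K hK
    obtain ⟨k4, k3, k2, k1⟩ := hK.iterated (m₂ := ν) (m₃ := μ) (m₄ := ν)
    rw [← lintegral_const_mul _ k1]
    refine lintegral_congr fun c => ?_
    rw [← lintegral_const_mul _ (k2 c)]
    refine lintegral_congr fun d => ?_
    rw [← lintegral_const_mul _ (k3 c d)]
    refine lintegral_congr fun a => ?_
    rw [← lintegral_const_mul _ (k4 c d a)]
  rw [pull _ q, mul_assoc, split _ _ q₁₂₃, split _ _ q₁₂, split _ _ q₁, e₁, e₂, e₃, e₄,
    ← mul_add, ← mul_add, ← mul_add, ← lintegral_add_left (hM h₁)]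
  congr 2
  have s12 : Measurable (Function.uncurry fun v y => G₁ v y + G₂ v y) := h₁.add h₂
  have s123 : Measurable (Function.uncurry fun v y => G₁ v y + G₂ v y + G₃ v y) := s12.add h₃
  simp_rw [← lintegral_add_left (hm h₁ _)]
  rw [← lintegral_add_left (hM s12)]
  simp_rw [← lintegral_add_left (hm s12 _)]
  rw [← lintegral_add_left (hM s123)]
  simp_rw [← lintegral_add_left (hm s123 _)]

section exclusion

variable {N : ℕ} {u : (Fin N → ℂ) → ℂ}

lemma measurable_vecPot (α : ℝ) (j : Fin N) : Measurable (vecPot α j) := by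
  unfold vecPot
  fun_prop

lemma measurable_covRe (α : ℝ) (hu : IsAnyonWF N u) (j : Fin N) : Measurable (covRe α u j) := by
  have h1 : Measurable fun x => fderiv ℝ u x (Pi.single j 1) :=
    ((hu.smooth.continuous_fderiv (by simp)).clm_apply continuous_const).measurable
  have h2 : Measurable u := hu.smooth.continuous.measurable
  have h3 := measurable_vecPot α j
  unfold covRe
  fun_prop

lemma measurable_covIm (α : ℝ) (hu : IsAnyonWF N u) (j : Fin N) : Measurable (covIm α u j) := by
  have h1 : Measurable fun x => fderiv ℝ u x (Pi.single j I) :=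
    ((hu.smooth.continuous_fderiv (by simp)).clm_apply continuous_const).measurable
  have h2 : Measurable u := hu.smooth.continuous.measurable
  have h3 := measurable_vecPot α j
  unfold covIm
  fun_prop

lemma ofReal_covSq (α : ℝ) (u : (Fin N → ℂ) → ℂ) (j : Fin N) (x : Fin N → ℂ) :
    ENNReal.ofReal (covSq α u j x) =
      ENNReal.ofReal (‖covRe α u j x‖ ^ 2) + ENNReal.ofReal (‖covIm α u j x‖ ^ 2) := by
  rw [covSq_eq, ENNReal.ofReal_add (by positivity) (by positivity)]

lemma measurable_ofReal_covSq (α : ℝ) (hu : IsAnyonWF N u) (j : Fin N) :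
    Measurable fun x => ENNReal.ofReal (covSq α u j x) := by
  have h1 := measurable_covRe α hu j
  have h2 := measurable_covIm α hu j
  simp_rw [covSq_eq]
  fun_prop

lemma measurable_ofReal_sq (hu : IsAnyonWF N u) :
    Measurable fun x => ENNReal.ofReal (‖u x‖ ^ 2) := by
  have h2 : Measurable u := hu.smooth.continuous.measurable
  fun_prop

/-- Occupation of a set by a particle, as an indicator. -/
def occ (Q : Set ℂ) (v : ℂ) : ℝ≥0∞ := Q.indicator 1 v

lemma measurable_occ {Q : Set ℂ} (hQ : MeasurableSet Q) : Measurable (occ Q) :=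
  measurable_one.indicator hQ

lemma occ_le_one (Q : Set ℂ) (v : ℂ) : occ Q v ≤ 1 := by
  unfold occ
  by_cases h : v ∈ Q <;> simp [h]

lemma lintegral_occ_mul {Q : Set ℂ} (hQ : MeasurableSet Q) (f : ℂ → ℝ≥0∞) :
    ∫⁻ v, occ Q v * f v = ∫⁻ v in Q, f v := by
  rw [← lintegral_indicator hQ]
  refine lintegral_congr fun v => ?_
  unfold occ
  by_cases h : v ∈ Q <;> simp [h]

/-- Expected number of particles in `Q`. -/
def mass (u : (Fin N → ℂ) → ℂ) (Q : Set ℂ) : ℝ≥0∞ :=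
  ∑ j : Fin N, ∫⁻ x : Fin N → ℂ, occ Q (x j) * ENNReal.ofReal (‖u x‖ ^ 2)

/-- Kinetic energy in `Q`. -/
def kinetic (α : ℝ) (u : (Fin N → ℂ) → ℂ) (Q : Set ℂ) : ℝ≥0∞ :=
  ∑ j : Fin N, ∫⁻ x : Fin N → ℂ, occ Q (x j) * ENNReal.ofReal (covSq α u j x)

/-- Inverse of one plus the number of particles in `Q` other than `j` and `k`. -/
def pairWeight (Q : Set ℂ) (j k : Fin N) (x : Fin N → ℂ) : ℝ≥0∞ :=
  (1 + ∑ l ∈ (Finset.univ.erase j).erase k, occ Q (x l))⁻¹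

lemma measurable_pairWeight {Q : Set ℂ} (hQ : MeasurableSet Q) (j k : Fin N) :
    Measurable (pairWeight Q j k) := by
  have := measurable_occ hQ
  unfold pairWeight
  fun_prop

lemma pairWeight_ne_top (Q : Set ℂ) (j k : Fin N) (x : Fin N → ℂ) : pairWeight Q j k x ≠ ⊤ := by
  simp [pairWeight]

lemma pairWeight_comm (Q : Set ℂ) (j k : Fin N) (x : Fin N → ℂ) :
    pairWeight Q j k x = pairWeight Q k j x := by
  rw [pairWeight, pairWeight, Finset.erase_right_comm]

lemma pairWeight_update (Q : Set ℂ) (j k : Fin N) (x : Fin N → ℂ) (y v : ℂ) :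
    pairWeight Q j k (Function.update (Function.update x k y) j v) = pairWeight Q j k x := by
  unfold pairWeight
  congr 2
  refine Finset.sum_congr rfl fun l hl => ?_
  rw [Function.update_of_ne (Finset.ne_of_mem_erase (Finset.mem_of_mem_erase hl)),
    Function.update_of_ne (Finset.ne_of_mem_erase hl)]

lemma sum_occ (Q : Set ℂ) (x : Fin N → ℂ) (A : Finset (Fin N)) [DecidablePred fun l => x l ∈ Q] :
    ∑ l ∈ A, occ Q (x l) = ((A.filter fun l => x l ∈ Q).card : ℝ≥0∞) := by
  rw [← Finset.sum_boole]
  refine Finset.sum_congr rfl fun l _ => ?_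
  unfold occ
  by_cases h : x l ∈ Q <;> simp [h]

open Classical in
lemma sum_pairWeight (Q : Set ℂ) (x : Fin N → ℂ) {j : Fin N} (hj : x j ∈ Q) :
    ∑ k ∈ Finset.univ.erase j, occ Q (x k) * pairWeight Q j k x =
      if 2 ≤ (Finset.univ.filter fun l => x l ∈ Q).card then 1 else 0 := by
  set S := Finset.univ.filter fun l => x l ∈ Q with hS
  have hjS : j ∈ S := by simp [hS, hj]
  have h1 : ∑ k ∈ Finset.univ.erase j, occ Q (x k) * pairWeight Q j k x =
      ∑ k ∈ S.erase j, ((S.card - 1 : ℕ) : ℝ≥0∞)⁻¹ := by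
    have hsub : S.erase j ⊆ Finset.univ.erase j := Finset.erase_subset_erase _ (by simp)
    rw [← Finset.sum_subset hsub]
    · refine Finset.sum_congr rfl fun k hk => ?_
      have hkS := Finset.mem_of_mem_erase hk
      have hkQ : x k ∈ Q := by simpa [hS] using hkS
      have hcard : (((Finset.univ.erase j).erase k).filter fun l => x l ∈ Q) =
          (S.erase j).erase k := by
        rw [hS, Finset.filter_erase, Finset.filter_erase]
      rw [pairWeight, sum_occ, hcard, Finset.card_erase_of_mem hk, Finset.card_erase_of_mem hjS]
      have hpos : 0 < (S.erase j).card := Finset.card_pos.2 ⟨k, hk⟩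
      rw [Finset.card_erase_of_mem hjS] at hpos
      have : (1 : ℝ≥0∞) + ((S.card - 1 - 1 : ℕ) : ℝ≥0∞) = ((S.card - 1 : ℕ) : ℝ≥0∞) := by
        rw [← Nat.cast_one, ← Nat.cast_add]
        congr 1
        omega
      rw [this]
      simp [occ, hkQ]
    · intro k hk hk'
      have : x k ∉ Q := by
        intro h
        exact hk' (Finset.mem_erase.2 ⟨Finset.ne_of_mem_erase hk, by simp [hS, h]⟩)
      simp [occ, this]
  rw [h1, Finset.sum_const, Finset.card_erase_of_mem hjS, nsmul_eq_mul]
  split_ifs with h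
  · have h0 : S.card - 1 ≠ 0 := by omega
    exact ENNReal.mul_inv_cancel (by exact_mod_cast h0) (ENNReal.natCast_ne_top _)
  · have : S.card - 1 = 0 := by omega
    simp [this]

lemma occ_mul_sum_pairWeight_le (Q : Set ℂ) (x : Fin N → ℂ) (j : Fin N) :
    occ Q (x j) * ∑ k ∈ Finset.univ.erase j, occ Q (x k) * pairWeight Q j k x ≤ occ Q (x j) := by
  classical
  by_cases h : x j ∈ Q
  · rw [sum_pairWeight Q x h]
    split_ifs <;> simp
  · simp [occ, h]

lemma sum_occ_le (Q : Set ℂ) (x : Fin N → ℂ) :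
    ∑ j, occ Q (x j) ≤ 1 + ∑ j, occ Q (x j) *
      ∑ k ∈ Finset.univ.erase j, occ Q (x k) * pairWeight Q j k x := by
  classical
  by_cases h : 2 ≤ (Finset.univ.filter fun l => x l ∈ Q).card
  · refine le_add_left (Finset.sum_le_sum fun j _ => ?_)
    by_cases hj : x j ∈ Q
    · rw [sum_pairWeight Q x hj, if_pos h, mul_one]
    · simp [occ, hj]
  · refine le_add_right ?_
    rw [sum_occ]
    exact_mod_cast (by omega : (Finset.univ.filter fun l => x l ∈ Q).card ≤ 1)

lemma lmarginal_pair {Q : Set ℂ} (hQ : MeasurableSet Q) {j k : Fin N} (hjk : j ≠ k)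
    {f : (Fin N → ℂ) → ℝ≥0∞} (hf : Measurable f) (x : Fin N → ℂ) :
    lmarginal (fun _ => volume) (insert k {j})
      (fun x => occ Q (x j) * (occ Q (x k) * (pairWeight Q j k x * f x))) x =
    pairWeight Q j k x * ∫⁻ y in Q, ∫⁻ v in Q,
      f (Function.update (Function.update x k y) j v) := by
  have hm : Measurable fun x : Fin N → ℂ =>
      occ Q (x j) * (occ Q (x k) * (pairWeight Q j k x * f x)) := by
    have := measurable_occ hQ
    have := measurable_pairWeight hQ j k
    fun_prop
  rw [lmarginal_insert _ hm (by simpa using hjk.symm)]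
  simp only [lmarginal_singleton, pairWeight_update, Function.update_self,
    Function.update_of_ne hjk.symm]
  simp_rw [lintegral_occ_mul hQ]
  rw [← lintegral_occ_mul hQ, ← lintegral_const_mul' _ _ (pairWeight_ne_top Q j k x)]
  refine lintegral_congr fun y => ?_
  have h1 : occ Q y ≠ ⊤ := ((occ_le_one Q y).trans_lt ENNReal.one_lt_top).ne
  rw [lintegral_const_mul' _ _ h1, lintegral_const_mul' _ _ (pairWeight_ne_top Q j k x)]
  ring

lemma measurable_two_update {f : (Fin N → ℂ) → ℝ≥0∞} (hf : Measurable f) (x : Fin N → ℂ)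
    (j k : Fin N) :
    Measurable (Function.uncurry fun v y => f (Function.update (Function.update x k y) j v)) := by
  refine hf.comp (measurable_pi_iff.2 fun l => ?_)
  rcases eq_or_ne l j with rfl | hlj
  · simpa using measurable_fst
  rcases eq_or_ne l k with rfl | hlk
  · simpa [hlj] using measurable_snd
  · simp [hlj, hlk]

lemma pair_exclusion (α : ℝ) (hu : IsAnyonWF N u) {j k : Fin N} (hjk : j ≠ k) (p q : ℝ) {ℓ : ℝ}
    (hℓ : 0 < ℓ) :
    ∫⁻ x, occ (cell p q ℓ) (x j) * (occ (cell p q ℓ) (x k) * (pairWeight (cell p q ℓ) j k x *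
      (ENNReal.ofReal (statC α N ^ 2) * ENNReal.ofReal (‖u x‖ ^ 2)))) ≤
    ∫⁻ x, occ (cell p q ℓ) (x j) * (occ (cell p q ℓ) (x k) * (pairWeight (cell p q ℓ) j k x *
      (ENNReal.ofReal (ℓ ^ 2) *
        (ENNReal.ofReal (covSq α u j x) + ENNReal.ofReal (covSq α u k x))))) := by
  have hQ := measurableSet_cell p q ℓ
  have hm0 : Measurable fun x => ENNReal.ofReal (statC α N ^ 2) * ENNReal.ofReal (‖u x‖ ^ 2) :=
    (measurable_ofReal_sq hu).const_mul _
  have hm1 : Measurable fun x => ENNReal.ofReal (covSq α u j x) + ENNReal.ofReal (covSq α u k x) :=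
    (measurable_ofReal_covSq α hu j).add (measurable_ofReal_covSq α hu k)
  have hm2 : Measurable fun x => ENNReal.ofReal (ℓ ^ 2) *
      (ENNReal.ofReal (covSq α u j x) + ENNReal.ofReal (covSq α u k x)) := hm1.const_mul _
  have ho := measurable_occ hQ
  have hw := measurable_pairWeight hQ j k
  refine lintegral_le_of_lmarginal_le (insert k {j}) (by fun_prop) (by fun_prop) fun x => ?_
  rw [lmarginal_pair hQ hjk hm0, lmarginal_pair hQ hjk hm2]
  refine mul_le_mul_right ?_ _
  have hr : ∀ {D : (Fin N → ℂ) → ℂ}, Measurable D →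
      Measurable fun x => ENNReal.ofReal (‖D x‖ ^ 2) := fun hD => by fun_prop
  refine (two_body_integrate
    (F := fun v y => ENNReal.ofReal (statC α N ^ 2) *
      ENNReal.ofReal (‖u (Function.update (Function.update x k y) j v)‖ ^ 2))
    (G₁ := fun v y => ENNReal.ofReal
      (‖covRe α u j (Function.update (Function.update x k y) j v)‖ ^ 2))
    (G₂ := fun v y => ENNReal.ofReal
      (‖covRe α u k (Function.update (Function.update x k y) j v)‖ ^ 2))
    (G₃ := fun v y => ENNReal.ofReal
      (‖covIm α u j (Function.update (Function.update x k y) j v)‖ ^ 2))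
    (G₄ := fun v y => ENNReal.ofReal
      (‖covIm α u k (Function.update (Function.update x k y) j v)‖ ^ 2))
    (measurable_two_update hm0 x j k) (measurable_two_update (hr (measurable_covRe α hu j)) x j k)
    (measurable_two_update (hr (measurable_covRe α hu k)) x j k)
    (measurable_two_update (hr (measurable_covIm α hu j)) x j k)
    (measurable_two_update (hr (measurable_covIm α hu k)) x j k)
    (ENNReal.ofReal ℓ) (p := p) (q := q) (ℓ := ℓ)
    (S := range (fun l => (x l).re) ∪ range (fun l => (x l).im))
    ((finite_range _).union (finite_range _)).countable ?_).trans (le_of_eq ?_)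
  · intro a ha b hb c hc d hd ha' hb' hc' hd' hac hbd
    refine exchange_bound α hu x hjk hℓ (Ioc_subset_Icc_self ha) (Ioc_subset_Icc_self hc)
      (Ioc_subset_Icc_self hb) (Ioc_subset_Icc_self hd) hac hbd
      (fun l => ⟨fun h => ha' (Or.inl ⟨l, h⟩), fun h => hc' (Or.inl ⟨l, h⟩)⟩)
      (fun l => ⟨fun h => hb' (Or.inr ⟨l, h⟩), fun h => hd' (Or.inr ⟨l, h⟩)⟩)
  · simp_rw [lintegral_const_mul' _ _ ENNReal.ofReal_ne_top]
    rw [← ENNReal.ofReal_mul hℓ.le, ← sq]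
    congr 1
    refine lintegral_congr fun y => lintegral_congr fun v => ?_
    rw [ofReal_covSq, ofReal_covSq]
    ring

/-- Local exclusion principle for anyons. -/
lemma local_exclusion (α : ℝ) (hu : IsAnyonWF N u)
    (h1 : ∫⁻ x, ENNReal.ofReal (‖u x‖ ^ 2) = 1) (p q : ℝ) {ℓ : ℝ} (hℓ : 0 < ℓ) :
    ENNReal.ofReal (statC α N ^ 2) * mass u (cell p q ℓ) ≤
      ENNReal.ofReal (statC α N ^ 2) +
        2 * ENNReal.ofReal (ℓ ^ 2) * kinetic α u (cell p q ℓ) := by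
  have hQ := measurableSet_cell p q ℓ
  set Q := cell p q ℓ with hQdef
  set C := ENNReal.ofReal (statC α N ^ 2) with hC
  have ho := measurable_occ hQ
  have hw := fun j k => measurable_pairWeight (N := N) hQ j k
  have hmu := measurable_ofReal_sq hu
  have hE := fun j => measurable_ofReal_covSq α hu j
  have hterm : ∀ j k, Measurable fun x : Fin N → ℂ => occ Q (x j) * (occ Q (x k) *
      (pairWeight Q j k x * (C * ENNReal.ofReal (‖u x‖ ^ 2)))) := fun j k => by
    have := hw j k
    fun_prop
  have step1 : C * mass u Q ≤ C + ∑ j, ∑ k ∈ Finset.univ.erase j,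
      ∫⁻ x, occ Q (x j) * (occ Q (x k) * (pairWeight Q j k x *
        (C * ENNReal.ofReal (‖u x‖ ^ 2)))) := by
    have e1 : C * mass u Q = ∫⁻ x, (∑ j, occ Q (x j)) * (C * ENNReal.ofReal (‖u x‖ ^ 2)) := by
      rw [mass, ← lintegral_finsetSum _ (fun j _ => by fun_prop),
        ← lintegral_const_mul _ (by fun_prop)]
      refine lintegral_congr fun x => ?_
      rw [← Finset.sum_mul]
      ring
    have e2 : C = ∫⁻ x, C * ENNReal.ofReal (‖u x‖ ^ 2) := by
      rw [lintegral_const_mul _ hmu, h1, mul_one]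
    rw [e1]
    nth_rewrite 2 [e2]
    have e3 : ∀ j, ∑ k ∈ Finset.univ.erase j, ∫⁻ x, occ Q (x j) * (occ Q (x k) *
        (pairWeight Q j k x * (C * ENNReal.ofReal (‖u x‖ ^ 2)))) =
        ∫⁻ x, ∑ k ∈ Finset.univ.erase j, occ Q (x j) * (occ Q (x k) *
          (pairWeight Q j k x * (C * ENNReal.ofReal (‖u x‖ ^ 2)))) := fun j =>
      (lintegral_finsetSum _ fun k _ => hterm j k).symm
    rw [Finset.sum_congr rfl fun j _ => e3 j,
      ← lintegral_finsetSum _ (fun j _ => Finset.measurable_sum _ fun k _ => hterm j k),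
      ← lintegral_add_left (hmu.const_mul C)]
    refine lintegral_mono fun x => ?_
    refine (mul_le_mul_left (sum_occ_le Q x) _).trans (le_of_eq ?_)
    rw [add_mul, one_mul, Finset.sum_mul]
    congr 1
    refine Finset.sum_congr rfl fun j _ => ?_
    rw [Finset.mul_sum, Finset.sum_mul]
    exact Finset.sum_congr rfl fun k _ => by ring
  refine step1.trans (add_le_add_right ?_ _)
  have step2 : ∑ j, ∑ k ∈ Finset.univ.erase j,
      ∫⁻ x, occ Q (x j) * (occ Q (x k) * (pairWeight Q j k x *
        (C * ENNReal.ofReal (‖u x‖ ^ 2)))) ≤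
      ∑ j, ∑ k ∈ Finset.univ.erase j, ENNReal.ofReal (ℓ ^ 2) *
        ((∫⁻ x, occ Q (x j) * (occ Q (x k) * pairWeight Q j k x) *
          ENNReal.ofReal (covSq α u j x)) +
        ∫⁻ x, occ Q (x k) * (occ Q (x j) * pairWeight Q k j x) *
          ENNReal.ofReal (covSq α u k x)) := by
    refine Finset.sum_le_sum fun j _ => Finset.sum_le_sum fun k hk => ?_
    refine (pair_exclusion α hu (Finset.ne_of_mem_erase hk).symm p q hℓ).trans (le_of_eq ?_)
    have := hw j k
    have := hw k j
    have := hE j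
    have := hE k
    rw [← lintegral_add_left (by fun_prop), ← lintegral_const_mul _ (by fun_prop)]
    refine lintegral_congr fun x => ?_
    rw [pairWeight_comm Q k j]
    ring
  refine step2.trans ?_
  have hswap : ∑ j, ∑ k ∈ Finset.univ.erase j,
      ∫⁻ x, occ Q (x k) * (occ Q (x j) * pairWeight Q k j x) *
          ENNReal.ofReal (covSq α u k x) =
      ∑ j, ∑ k ∈ Finset.univ.erase j,
        ∫⁻ x, occ Q (x j) * (occ Q (x k) * pairWeight Q j k x) *
          ENNReal.ofReal (covSq α u j x) := by
    refine Finset.sum_comm' fun j k => ?_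
    simp [eq_comm]
  simp_rw [← Finset.mul_sum, Finset.sum_add_distrib]
  rw [hswap, ← two_mul, mul_left_comm, ← mul_assoc]
  refine mul_le_mul_right (Finset.sum_le_sum fun j _ => ?_) _
  rw [← lintegral_finsetSum _ (fun k _ => by
    have := hw j k
    have := hE j
    fun_prop)]
  refine lintegral_mono fun x => ?_
  rw [← Finset.sum_mul, ← Finset.mul_sum]
  exact mul_le_mul_left (occ_mul_sum_pairWeight_le Q x j) _

end exclusion

section uncertainty

variable {n : ℕ} {u : (Fin (n + 1) → ℂ) → ℂ}

/-- The one-particle marginal of `f` with the `j`-th particle at `y`. -/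
def marg (j : Fin (n + 1)) (f : (Fin (n + 1) → ℂ) → ℝ≥0∞) (y : ℂ) : ℝ≥0∞ :=
  ∫⁻ z : Fin n → ℂ, f (j.insertNth y z)

lemma measurable_insertNth_prod (j : Fin (n + 1)) :
    Measurable fun z : ℂ × (Fin n → ℂ) => (j.insertNth z.1 z.2 : Fin (n + 1) → ℂ) :=
  (MeasurableEquiv.piFinSuccAbove (fun _ => ℂ) j).symm.measurable

lemma measurable_marg (j : Fin (n + 1)) {f : (Fin (n + 1) → ℂ) → ℝ≥0∞} (hf : Measurable f) :
    Measurable (marg j f) :=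
  Measurable.lintegral_prod_right' (f := fun z : ℂ × (Fin n → ℂ) => f (j.insertNth z.1 z.2))
    (hf.comp (measurable_insertNth_prod j))

lemma lintegral_mul_eq_marg (j : Fin (n + 1)) {f : (Fin (n + 1) → ℂ) → ℝ≥0∞} (hf : Measurable f)
    {W : ℂ → ℝ≥0∞} (hW : Measurable W) :
    ∫⁻ x, W (x j) * f x = ∫⁻ y, W y * marg j f y := by
  have h := (volume_preserving_piFinSuccAbove (fun _ : Fin (n + 1) => ℂ) j).symm.lintegral_comp_emb
    (MeasurableEquiv.measurableEmbedding _) (fun x => W (x j) * f x)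
  rw [← h, Measure.volume_eq_prod, lintegral_prod]
  · refine lintegral_congr fun y => ?_
    have h2 : ∀ z : Fin n → ℂ,
        (MeasurableEquiv.piFinSuccAbove (fun _ => ℂ) j).symm (y, z) = j.insertNth y z :=
      fun z => rfl
    simp_rw [h2, Fin.insertNth_apply_same]
    rw [marg, lintegral_const_mul]
    exact hf.comp ((measurable_insertNth_prod j).comp measurable_prodMk_left)
  · have h3 : Measurable fun x : Fin (n + 1) → ℂ => W (x j) * f x := by fun_prop
    exact (h3.comp (MeasurableEquiv.measurable _)).aemeasurable

lemma marg_add (j : Fin (n + 1)) {f g : (Fin (n + 1) → ℂ) → ℝ≥0∞} (hf : Measurable f) (y : ℂ) :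
    marg j (fun x => f x + g x) y = marg j f y + marg j g y :=
  lintegral_add_left (hf.comp ((measurable_insertNth_prod j).comp measurable_prodMk_left)) _

lemma marg_const_mul (j : Fin (n + 1)) {f : (Fin (n + 1) → ℂ) → ℝ≥0∞} {c : ℝ≥0∞} (hc : c ≠ ⊤)
    (y : ℂ) : marg j (fun x => c * f x) y = c * marg j f y :=
  lintegral_const_mul' _ _ hc

lemma marg_le_of_forall {j : Fin (n + 1)} {f g : (Fin (n + 1) → ℂ) → ℝ≥0∞} (hg : Measurable g)
    {γ : ℝ → ℂ} (hγ : Measurable γ) {A : Set ℝ} {y : ℂ}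
    (h : ∀ w, f (Function.update w j y) ≤ ∫⁻ s in A, g (Function.update w j (γ s))) :
    marg j f y ≤ ∫⁻ s in A, marg j g (γ s) := by
  have h1 : marg j f y ≤ ∫⁻ z : Fin n → ℂ, ∫⁻ s in A, g (j.insertNth (γ s) z) := by
    refine lintegral_mono fun z => ?_
    simpa only [Fin.update_insertNth] using h (j.insertNth y z)
  refine h1.trans (le_of_eq (lintegral_lintegral_swap ?_))
  exact (hg.comp ((measurable_insertNth_prod j).comp
    ((hγ.comp measurable_snd).prodMk measurable_fst))).aemeasurable

/-- One-particle density, with values in `[0, ∞]`. -/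
def dens (u : (Fin (n + 1) → ℂ) → ℂ) (y : ℂ) : ℝ≥0∞ :=
  ∑ j, marg j (fun x => ENNReal.ofReal (‖u x‖ ^ 2)) y

lemma measurable_dens (hu : IsAnyonWF (n + 1) u) : Measurable (dens u) :=
  Finset.measurable_sum _ fun j _ => measurable_marg j (measurable_ofReal_sq hu)

lemma sum_lintegral_mul_eq_dens (hu : IsAnyonWF (n + 1) u) {W : ℂ → ℝ≥0∞} (hW : Measurable W) :
    ∑ j, ∫⁻ x, W (x j) * ENNReal.ofReal (‖u x‖ ^ 2) = ∫⁻ y, W y * dens u y := by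
  have hm := fun j => measurable_marg j (measurable_ofReal_sq hu)
  simp_rw [dens, Finset.mul_sum]
  rw [lintegral_finsetSum _ fun j _ => by have := hm j; fun_prop]
  exact Finset.sum_congr rfl fun j _ => lintegral_mul_eq_marg j (measurable_ofReal_sq hu) hW

lemma mass_eq_dens (hu : IsAnyonWF (n + 1) u) {Q : Set ℂ} (hQ : MeasurableSet Q) :
    mass u Q = ∫⁻ y in Q, dens u y := by
  rw [mass, sum_lintegral_mul_eq_dens hu (measurable_occ hQ), lintegral_occ_mul hQ]

/-- Kinetic energy density, with values in `[0, ∞]`. -/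
def kinDens (α : ℝ) (u : (Fin (n + 1) → ℂ) → ℂ) (y : ℂ) : ℝ≥0∞ :=
  ∑ j, marg j (fun x => ENNReal.ofReal (covSq α u j x)) y

lemma measurable_kinDens (α : ℝ) (hu : IsAnyonWF (n + 1) u) : Measurable (kinDens α u) :=
  Finset.measurable_sum _ fun j _ => measurable_marg j (measurable_ofReal_covSq α hu j)

lemma kinetic_eq_kinDens (α : ℝ) (hu : IsAnyonWF (n + 1) u) {Q : Set ℂ} (hQ : MeasurableSet Q) :
    kinetic α u Q = ∫⁻ y in Q, kinDens α u y := by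
  rw [kinetic]
  simp_rw [kinDens]
  rw [lintegral_finsetSum _ fun j _ => measurable_marg j (measurable_ofReal_covSq α hu j)]
  refine Finset.sum_congr rfl fun j _ => ?_
  rw [lintegral_mul_eq_marg j (measurable_ofReal_covSq α hu j) (measurable_occ hQ),
    lintegral_occ_mul hQ]

lemma dens_le_of_forall (α : ℝ) (hu : IsAnyonWF (n + 1) u) {A B : ℝ} {γ : ℝ → ℂ}
    (hγ : Measurable γ) {S : Set ℝ} {y : ℂ} {D : Fin (n + 1) → (Fin (n + 1) → ℂ) → ℂ}
    (hD : ∀ j x, ENNReal.ofReal (‖D j x‖ ^ 2) ≤ ENNReal.ofReal (covSq α u j x))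
    (h : ∀ w j, ENNReal.ofReal (‖u (Function.update w j y)‖ ^ 2) ≤ ∫⁻ s in S,
      (ENNReal.ofReal A * ENNReal.ofReal (‖u (Function.update w j (γ s))‖ ^ 2) +
        ENNReal.ofReal B * ENNReal.ofReal (‖D j (Function.update w j (γ s))‖ ^ 2))) :
    dens u y ≤ ∫⁻ s in S,
      (ENNReal.ofReal A * dens u (γ s) + ENNReal.ofReal B * kinDens α u (γ s)) := by
  have hu' := measurable_ofReal_sq hu
  have hk := measurable_ofReal_covSq α hu
  have hg : ∀ j, Measurable fun x => ENNReal.ofReal A * ENNReal.ofReal (‖u x‖ ^ 2) +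
      ENNReal.ofReal B * ENNReal.ofReal (covSq α u j x) := fun j =>
    (hu'.const_mul _).add ((hk j).const_mul _)
  have h1 : ∀ j, marg j (fun x => ENNReal.ofReal (‖u x‖ ^ 2)) y ≤ ∫⁻ s in S,
      marg j (fun x => ENNReal.ofReal A * ENNReal.ofReal (‖u x‖ ^ 2) +
        ENNReal.ofReal B * ENNReal.ofReal (covSq α u j x)) (γ s) := fun j =>
    marg_le_of_forall (hg j) hγ fun w => (h w j).trans
      (lintegral_mono fun s => add_le_add_right (mul_le_mul_right (hD j _) _) _)
  refine (Finset.sum_le_sum fun j _ => h1 j).trans (le_of_eq ?_)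
  have hm := fun j => measurable_marg j (hg j)
  rw [← lintegral_finsetSum _ fun j _ => by have := hm j; fun_prop]
  refine lintegral_congr fun s => ?_
  rw [dens, kinDens, Finset.mul_sum, Finset.mul_sum, ← Finset.sum_add_distrib]
  refine Finset.sum_congr rfl fun j _ => ?_
  rw [marg_add j (hu'.const_mul _), marg_const_mul j ENNReal.ofReal_ne_top,
    marg_const_mul j ENNReal.ofReal_ne_top]

lemma setLIntegral_sq_le_of_marginal {f e : ℂ → ℝ≥0∞} (hf : Measurable f) (he : Measurable e)
    (p q ℓ : ℝ)
    (h1 : ∀ a ∈ Ioc p (p + ℓ), ∀ b ∈ Ioc q (q + ℓ),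
      f ⟨a, b⟩ ≤ ∫⁻ s in Ioc p (p + ℓ), e ⟨s, b⟩)
    (h2 : ∀ a ∈ Ioc p (p + ℓ), ∀ b ∈ Ioc q (q + ℓ),
      f ⟨a, b⟩ ≤ ∫⁻ s in Ioc q (q + ℓ), e ⟨a, s⟩) :
    ∫⁻ y in cell p q ℓ, f y ^ 2 ≤ (∫⁻ y in cell p q ℓ, e y) ^ 2 := by
  have hm : Measurable fun z : ℝ × ℝ => e ⟨z.1, z.2⟩ := he.comp measurable_mk
  have hH : Measurable fun a => ∫⁻ s in Ioc q (q + ℓ), e ⟨a, s⟩ := hm.lintegral_prod_right'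
  have hG : Measurable fun b => ∫⁻ s in Ioc p (p + ℓ), e ⟨s, b⟩ := hm.lintegral_prod_left'
  have hswap : ∫⁻ b in Ioc q (q + ℓ), ∫⁻ s in Ioc p (p + ℓ), e ⟨s, b⟩ =
      ∫⁻ y in cell p q ℓ, e y := by
    rw [setLIntegral_cell he, lintegral_lintegral_swap]
    exact (hm.comp measurable_swap).aemeasurable
  calc ∫⁻ y in cell p q ℓ, f y ^ 2
      = ∫⁻ a in Ioc p (p + ℓ), ∫⁻ b in Ioc q (q + ℓ), f ⟨a, b⟩ ^ 2 :=
        setLIntegral_cell (hf.pow_const 2) p q ℓ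
    _ ≤ ∫⁻ a in Ioc p (p + ℓ), ∫⁻ b in Ioc q (q + ℓ), (∫⁻ s in Ioc q (q + ℓ), e ⟨a, s⟩) *
          ∫⁻ s in Ioc p (p + ℓ), e ⟨s, b⟩ := by
        refine setLIntegral_mono' measurableSet_Ioc fun a ha =>
          setLIntegral_mono' measurableSet_Ioc fun b hb => ?_
        rw [sq]
        exact mul_le_mul' (h2 a ha b hb) (h1 a ha b hb)
    _ = (∫⁻ y in cell p q ℓ, e y) ^ 2 := by
        simp_rw [lintegral_const_mul _ hG]
        rw [lintegral_mul_const _ hH, hswap, ← setLIntegral_cell he, sq]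

/-- Local uncertainty principle. -/
lemma local_uncertainty (α : ℝ) (hu : IsAnyonWF (n + 1) u) (p q : ℝ) {ℓ t : ℝ} (hℓ : 0 < ℓ)
    (ht : 0 < t) :
    ∫⁻ y in cell p q ℓ, dens u y ^ 2 ≤
      (ENNReal.ofReal (1 / ℓ + t) * mass u (cell p q ℓ) +
        ENNReal.ofReal (1 / t) * kinetic α u (cell p q ℓ)) ^ 2 := by
  have hd := measurable_dens hu
  have hk := measurable_kinDens α hu
  have hQ := measurableSet_cell p q ℓ
  refine (setLIntegral_sq_le_of_marginal hd ((hd.const_mul (ENNReal.ofReal (1 / ℓ + t))).add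
    (hk.const_mul (ENNReal.ofReal (1 / t)))) p q ℓ ?_ ?_).trans (le_of_eq ?_)
  · intro a ha b hb
    refine dens_le_of_forall α hu (γ := fun s => ⟨s, b⟩) (D := covRe α u)
      (measurable_mk.comp measurable_prodMk_right) (fun j x => ?_) fun w j =>
      density_horizontal_le α hu.smooth w j b hℓ ht (Ioc_subset_Icc_self ha)
    rw [ofReal_covSq]
    exact le_self_add
  · intro a ha b hb
    refine dens_le_of_forall α hu (γ := fun s => ⟨a, s⟩) (D := covIm α u)
      (measurable_mk.comp measurable_prodMk_left) (fun j x => ?_) fun w j =>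
      density_vertical_le α hu.smooth w j a hℓ ht (Ioc_subset_Icc_self hb)
    rw [ofReal_covSq]
    exact le_add_self
  · rw [mass_eq_dens hu hQ, kinetic_eq_kinDens α hu hQ]
    simp only [Pi.add_apply]
    rw [lintegral_add_left (hd.const_mul _), lintegral_const_mul _ hd, lintegral_const_mul _ hk]

end uncertainty

section iteration

/-- Iterated subdivision of squares: local exclusion and local uncertainty combine to a bound on
every square carrying mass at least two. -/
lemma subdivision_bound {m T R : ℝ → ℝ → ℝ → ℝ} {c δ : ℝ} (hc : 0 < c) (hc1 : c ≤ 1) (hδ : 0 < δ)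
    (hm0 : ∀ p q ℓ, 0 ≤ m p q ℓ) (hT0 : ∀ p q ℓ, 0 ≤ T p q ℓ)
    (hex : ∀ p q ℓ, 0 < ℓ → c ^ 2 * m p q ℓ ≤ c ^ 2 + 2 * ℓ ^ 2 * T p q ℓ)
    (hun : ∀ p q ℓ t, 0 < ℓ → 0 < t →
      R p q ℓ ≤ ((1 / ℓ + t) * m p q ℓ + 1 / t * T p q ℓ) ^ 2)
    (hR : ∀ p q ℓ, 0 < ℓ → R p q ℓ = R p q (ℓ / 2) + R p (q + ℓ / 2) (ℓ / 2) +
      (R (p + ℓ / 2) q (ℓ / 2) + R (p + ℓ / 2) (q + ℓ / 2) (ℓ / 2)))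
    (hT : ∀ p q ℓ, 0 < ℓ → T p q ℓ = T p q (ℓ / 2) + T p (q + ℓ / 2) (ℓ / 2) +
      (T (p + ℓ / 2) q (ℓ / 2) + T (p + ℓ / 2) (q + ℓ / 2) (ℓ / 2)))
    (hδm : ∀ p q ℓ, 0 < ℓ → ℓ < δ → m p q ℓ < 2) {p q ℓ : ℝ} (hℓ : 0 < ℓ) (h2 : 2 ≤ m p q ℓ) :
    R p q ℓ + 128 * (1 / ℓ) ^ 2 ≤ 1298 / c ^ 2 * T p q ℓ := by
  have hcc : 0 < c ^ 2 := by positivity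
  have hK : 18 ≤ 1298 / c ^ 2 := by
    rw [le_div_iff₀ hcc]
    nlinarith
  have hleaf : ∀ p q ℓ, 0 < ℓ → m p q ℓ < 2 → R p q ℓ ≤ 32 * (1 / ℓ) ^ 2 + 18 * T p q ℓ := by
    intro p q ℓ hℓ hm
    have hr : 0 < 1 / ℓ := by positivity
    set r := 1 / ℓ with hr'
    have hs := Real.sqrt_nonneg (T p q ℓ)
    have hsq := Real.sq_sqrt (hT0 p q ℓ)
    set s := √(T p q ℓ) with hs'
    have h := hun p q ℓ (s + r) hℓ (by positivity)
    have h3 : 1 / (s + r) * T p q ℓ ≤ s := by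
      rw [one_div, inv_mul_le_iff₀ (by positivity)]
      nlinarith
    have h4 : (r + (s + r)) * m p q ℓ ≤ (r + (s + r)) * 2 :=
      mul_le_mul_of_nonneg_left hm.le (by positivity)
    have h5 : 0 ≤ (r + (s + r)) * m p q ℓ + 1 / (s + r) * T p q ℓ := by
      have := hm0 p q ℓ
      have := hT0 p q ℓ
      positivity
    have h6 : ((r + (s + r)) * m p q ℓ + 1 / (s + r) * T p q ℓ) ^ 2 ≤ (4 * r + 3 * s) ^ 2 :=
      pow_le_pow_left₀ h5 (by linarith) 2
    nlinarith [sq_nonneg (4 * r - 3 * s)]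
  obtain ⟨n, hn⟩ : ∃ n : ℕ, ℓ < δ * 2 ^ n := by
    obtain ⟨n, hn⟩ := pow_unbounded_of_one_lt (ℓ / δ) (one_lt_two : (1 : ℝ) < 2)
    exact ⟨n, by rwa [div_lt_iff₀' hδ] at hn⟩
  induction n generalizing p q ℓ with
  | zero => exact absurd (hδm p q ℓ hℓ (by simpa using hn)) (not_lt.2 h2)
  | succ n ih =>
    have hn' : ℓ / 2 < δ * 2 ^ n := by
      rw [pow_succ] at hn
      linarith
    have hℓ2 : 0 < ℓ / 2 := by positivity
    have hhalf : (1 / (ℓ / 2)) ^ 2 = 4 * (1 / ℓ) ^ 2 := by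
      field_simp
      norm_num
    have hr0 : 0 < (1 / ℓ) ^ 2 := by positivity
    set r := (1 / ℓ) ^ 2 with hr
    set K := 1298 / c ^ 2 with hKdef
    have hchild : ∀ p q, R p q (ℓ / 2) + 512 * r ≤ K * T p q (ℓ / 2) ∨
        R p q (ℓ / 2) ≤ 128 * r + 18 * T p q (ℓ / 2) := by
      intro p q
      rcases lt_or_ge (m p q (ℓ / 2)) 2 with h | h
      · refine Or.inr ?_
        have := hleaf p q _ hℓ2 h
        rw [hhalf] at this
        linarith
      · refine Or.inl ?_
        have := ih hℓ2 h hn'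
        rw [hhalf] at this
        linarith
    have hmono : ∀ p q, 18 * T p q (ℓ / 2) ≤ K * T p q (ℓ / 2) := fun p q =>
      mul_le_mul_of_nonneg_right hK (hT0 _ _ _)
    have hnode : 640 * r + 18 * T p q ℓ ≤ K * T p q ℓ := by
      have h3 := hex p q ℓ hℓ
      have h4 : c ^ 2 * 2 ≤ c ^ 2 * m p q ℓ := mul_le_mul_of_nonneg_left h2 hcc.le
      have h5 : c ^ 2 * r ≤ 2 * T p q ℓ := by
        rw [hr, one_div, inv_pow, ← div_eq_mul_inv, div_le_iff₀ (by positivity)]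
        linarith
      have h6 := hT0 p q ℓ
      have h7 : 18 * c ^ 2 * T p q ℓ ≤ 18 * T p q ℓ := by
        nlinarith [mul_le_mul_of_nonneg_right (pow_le_one₀ (n := 2) hc.le hc1) h6]
      rw [hKdef, div_mul_eq_mul_div, le_div_iff₀ hcc]
      linarith
    have hTs := congrArg (K * ·) (hT p q ℓ hℓ)
    simp only [mul_add] at hTs
    have hT' := hT p q ℓ hℓ
    rw [hR p q ℓ hℓ]
    have m1 := hmono p q
    have m2 := hmono p (q + ℓ / 2)
    have m3 := hmono (p + ℓ / 2) q
    have m4 := hmono (p + ℓ / 2) (q + ℓ / 2)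
    rcases hchild p q with h1 | h1 <;> rcases hchild p (q + ℓ / 2) with h2 | h2 <;>
      rcases hchild (p + ℓ / 2) q with h3 | h3 <;>
      rcases hchild (p + ℓ / 2) (q + ℓ / 2) with h4 | h4 <;> linarith

lemma setLIntegral_cell_split (f : ℂ → ℝ≥0∞) (p q : ℝ) {ℓ : ℝ} (hℓ : 0 < ℓ) :
    ∫⁻ y in cell p q ℓ, f y =
      (∫⁻ y in cell p q (ℓ / 2), f y) + (∫⁻ y in cell p (q + ℓ / 2) (ℓ / 2), f y) +
      ((∫⁻ y in cell (p + ℓ / 2) q (ℓ / 2), f y) +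
        ∫⁻ y in cell (p + ℓ / 2) (q + ℓ / 2) (ℓ / 2), f y) := by
  have hI : ∀ p, Ioc p (p + ℓ) = Ioc p (p + ℓ / 2) ∪ Ioc (p + ℓ / 2) (p + ℓ / 2 + ℓ / 2) := by
    intro p
    rw [Ioc_union_Ioc_eq_Ioc (by linarith) (by linarith)]
    congr 1
    ring
  have hd : ∀ p, Disjoint (Ioc p (p + ℓ / 2)) (Ioc (p + ℓ / 2) (p + ℓ / 2 + ℓ / 2)) := fun p =>
    Ioc_disjoint_Ioc_of_le le_rfl
  have hu1 : ∀ A : Set ℝ, A ×ℂ Ioc q (q + ℓ) = (A ×ℂ Ioc q (q + ℓ / 2)) ∪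
      (A ×ℂ Ioc (q + ℓ / 2) (q + ℓ / 2 + ℓ / 2)) := by
    intro A
    rw [hI q]
    ext z
    simp only [mem_reProdIm, mem_union]
    tauto
  have hu2 : cell p q ℓ = (Ioc p (p + ℓ / 2) ×ℂ Ioc q (q + ℓ)) ∪
      (Ioc (p + ℓ / 2) (p + ℓ / 2 + ℓ / 2) ×ℂ Ioc q (q + ℓ)) := by
    rw [cell, hI p]
    ext z
    simp only [mem_reProdIm, mem_union]
    tauto
  have hmeas : ∀ a b c d : ℝ, MeasurableSet (Ioc a b ×ℂ Ioc c d) := fun a b c d =>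
    (measurableSet_Ioc.preimage measurable_re).inter (measurableSet_Ioc.preimage measurable_im)
  rw [hu2, lintegral_union (hmeas _ _ _ _), hu1, hu1, lintegral_union (hmeas _ _ _ _),
    lintegral_union (hmeas _ _ _ _)]
  · rfl
  · exact Set.disjoint_left.2 fun z h1 h2 => Set.disjoint_left.1 (hd q) h1.2 h2.2
  · exact Set.disjoint_left.2 fun z h1 h2 => Set.disjoint_left.1 (hd q) h1.2 h2.2
  · exact Set.disjoint_left.2 fun z h1 h2 => Set.disjoint_left.1 (hd p) h1.1 h2.1

lemma volume_cell (p q ℓ : ℝ) : volume (cell p q ℓ) = ENNReal.ofReal ℓ * ENNReal.ofReal ℓ := by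
  rw [← setLIntegral_one, setLIntegral_cell measurable_const]
  simp

lemma exists_forall_cell_lt {f : ℂ → ℝ≥0∞} (hf : ∫⁻ y, f y ≠ ⊤) {ε : ℝ≥0∞} (hε : ε ≠ 0) :
    ∃ δ : ℝ, 0 < δ ∧ ∀ p q ℓ, 0 < ℓ → ℓ < δ → ∫⁻ y in cell p q ℓ, f y < ε := by
  obtain ⟨η, hη, h⟩ := exists_pos_setLIntegral_lt_of_measure_lt hf hε
  obtain ⟨r, hr, hrη⟩ := ENNReal.lt_iff_exists_nnreal_btwn.1 hη
  have hr0 : 0 < (r : ℝ) := by exact_mod_cast hr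
  refine ⟨min 1 r, lt_min one_pos hr0, fun p q ℓ hℓ hlt => h _ ?_⟩
  rw [volume_cell]
  refine lt_of_le_of_lt ?_ hrη
  have h1 : ENNReal.ofReal ℓ ≤ 1 := ENNReal.ofReal_le_one.2 (hlt.le.trans (min_le_left _ _))
  have h2 : ENNReal.ofReal ℓ ≤ r := by
    rw [← ENNReal.ofReal_coe_nnreal]
    exact ENNReal.ofReal_le_ofReal (hlt.le.trans (min_le_right _ _))
  calc ENNReal.ofReal ℓ * ENNReal.ofReal ℓ ≤ 1 * r := mul_le_mul' h1 h2
    _ = r := one_mul _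

end iteration

section liebThirring

lemma ofReal_mul_le_weighted {K : ℝ} (hK : 0 < K) {w : ℝ} (hw : 0 ≤ w) (d : ℝ≥0∞) :
    ENNReal.ofReal w * d ≤
      ENNReal.ofReal (1 / K) * d ^ 2 + ENNReal.ofReal (K / 4) * ENNReal.ofReal (w ^ 2) := by
  induction d with
  | top =>
    have : ENNReal.ofReal (1 / K) ≠ 0 := by simpa using hK
    rw [ENNReal.top_pow two_ne_zero, ENNReal.mul_top this, top_add]
    exact le_top
  | coe d =>
    rw [← ENNReal.ofReal_coe_nnreal, ← ENNReal.ofReal_pow d.coe_nonneg, ← ENNReal.ofReal_mul hw,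
      ← ENNReal.ofReal_mul (by positivity), ← ENNReal.ofReal_mul (by positivity),
      ← ENNReal.ofReal_add (by positivity) (by positivity)]
    refine ENNReal.ofReal_le_ofReal ?_
    have h : 1 / K * (d : ℝ) ^ 2 + K / 4 * w ^ 2 - w * d = 1 / K * (d - K / 2 * w) ^ 2 := by
      field_simp
      ring
    have : 0 ≤ 1 / K * ((d : ℝ) - K / 2 * w) ^ 2 := by positivity
    linarith

lemma lintegral_sq_eq_one {N : ℕ} {u : (Fin N → ℂ) → ℂ} (hu : IsAnyonWF N u)
    (h1 : ∫ x : Fin N → ℂ, ‖u x‖ ^ 2 = 1) : ∫⁻ x, ENNReal.ofReal (‖u x‖ ^ 2) = 1 := by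
  have hc : Continuous fun x => ‖u x‖ ^ 2 := hu.smooth.continuous.norm.pow 2
  have hs : HasCompactSupport fun x => ‖u x‖ ^ 2 :=
    hu.compactSupport.comp_left (g := fun v => ‖v‖ ^ 2) (by simp)
  rw [← ofReal_integral_eq_lintegral_ofReal (hc.integrable_of_hasCompactSupport hs)
    (ae_of_all _ fun x => by positivity), h1, ENNReal.ofReal_one]

variable {n : ℕ} {u : (Fin (n + 1) → ℂ) → ℂ}

lemma exists_cell_support (hu : IsAnyonWF (n + 1) u) :
    ∃ p ℓ : ℝ, 0 < ℓ ∧ ∀ x, u x ≠ 0 → ∀ j, x j ∈ cell p p ℓ := by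
  obtain ⟨r, hr⟩ := hu.compactSupport.isCompact.isBounded.subset_closedBall 0
  have hr0 : ∀ x, u x ≠ 0 → ∀ j, ‖x j‖ ≤ r := fun x hx j =>
    (norm_le_pi_norm x j).trans (mem_closedBall_zero_iff.1 (hr (subset_tsupport _ hx)))
  refine ⟨-(|r| + 1), 2 * (|r| + 1), by positivity, fun x hx j => ?_⟩
  have h1 := abs_le.1 ((abs_re_le_norm (x j)).trans (hr0 x hx j))
  have h2 := abs_le.1 ((abs_im_le_norm (x j)).trans (hr0 x hx j))
  have h3 := le_abs_self r
  refine ⟨⟨?_, ?_⟩, ?_, ?_⟩ <;> linarith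

lemma mass_le (u : (Fin (n + 1) → ℂ) → ℂ) (h1 : ∫⁻ x, ENNReal.ofReal (‖u x‖ ^ 2) = 1)
    (Q : Set ℂ) : mass u Q ≤ (n + 1 : ℕ) := by
  have h : mass u Q ≤ ∑ _j : Fin (n + 1), ∫⁻ x, ENNReal.ofReal (‖u x‖ ^ 2) :=
    Finset.sum_le_sum fun j _ => lintegral_mono fun x => mul_le_of_le_one_left' (occ_le_one Q _)
  rw [h1] at h
  simpa using h

lemma kinetic_le (α : ℝ) (u : (Fin (n + 1) → ℂ) → ℂ) (Q : Set ℂ) :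
    kinetic α u Q ≤ ∑ j, ∫⁻ x, ENNReal.ofReal (covSq α u j x) :=
  Finset.sum_le_sum fun _ _ => lintegral_mono fun _ => mul_le_of_le_one_left' (occ_le_one Q _)

/-- The kinetic energy controls the square integral of the density on any square that carries
mass at least two. -/
lemma lintegral_dens_sq_le (α : ℝ) (hn : 2 ≤ n + 1) (hα : 0 < statC α (n + 1))
    (hu : IsAnyonWF (n + 1) u) (h1 : ∫⁻ x, ENNReal.ofReal (‖u x‖ ^ 2) = 1)
    (hfin : ∑ j, ∫⁻ x, ENNReal.ofReal (covSq α u j x) ≠ ⊤) (p q : ℝ) {ℓ : ℝ} (hℓ : 0 < ℓ)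
    (h2 : 2 ≤ mass u (cell p q ℓ)) :
    ∫⁻ y in cell p q ℓ, dens u y ^ 2 ≤
      ENNReal.ofReal (1298 / statC α (n + 1) ^ 2) * kinetic α u (cell p q ℓ) := by
  have hM : ∀ Q, mass u Q ≠ ⊤ := fun Q => ne_top_of_le_ne_top (by simp) (mass_le u h1 Q)
  have hT : ∀ Q, kinetic α u Q ≠ ⊤ := fun Q => ne_top_of_le_ne_top hfin (kinetic_le α u Q)
  have hunc : ∀ p q ℓ t, 0 < ℓ → 0 < t → (ENNReal.ofReal (1 / ℓ + t) * mass u (cell p q ℓ) +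
      ENNReal.ofReal (1 / t) * kinetic α u (cell p q ℓ)) ^ 2 ≠ ⊤ := fun p q ℓ t _ _ =>
    ENNReal.pow_ne_top (ENNReal.add_ne_top.2 ⟨ENNReal.mul_ne_top ENNReal.ofReal_ne_top (hM _),
      ENNReal.mul_ne_top ENNReal.ofReal_ne_top (hT _)⟩)
  have hR : ∀ p q ℓ, 0 < ℓ → ∫⁻ y in cell p q ℓ, dens u y ^ 2 ≠ ⊤ := fun p q ℓ hℓ =>
    ne_top_of_le_ne_top (hunc p q ℓ 1 hℓ one_pos) (local_uncertainty α hu p q hℓ one_pos)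
  have hdens : ∫⁻ y, dens u y ≠ ⊤ := by
    have h := mass_eq_dens hu MeasurableSet.univ
    rw [setLIntegral_univ] at h
    exact h ▸ hM _
  obtain ⟨δ, hδ, hδm⟩ := exists_forall_cell_lt hdens two_ne_zero
  have key := subdivision_bound (m := fun p q ℓ => (mass u (cell p q ℓ)).toReal)
    (T := fun p q ℓ => (kinetic α u (cell p q ℓ)).toReal)
    (R := fun p q ℓ => (∫⁻ y in cell p q ℓ, dens u y ^ 2).toReal) hα (statC_le_one _ hn) hδ
    (fun _ _ _ => ENNReal.toReal_nonneg) (fun _ _ _ => ENNReal.toReal_nonneg)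
    ?_ ?_ ?_ ?_ ?_ (p := p) (q := q) hℓ ?_
  · rw [← ENNReal.ofReal_toReal (hR p q ℓ hℓ), ← ENNReal.ofReal_toReal (hT (cell p q ℓ)),
      ← ENNReal.ofReal_mul (by positivity)]
    refine ENNReal.ofReal_le_ofReal (le_trans ?_ key)
    have : 0 ≤ 128 * (1 / ℓ) ^ 2 := by positivity
    linarith
  · intro p q ℓ hℓ
    have h := ENNReal.toReal_mono (by finiteness [hT (cell p q ℓ)]) (local_exclusion α hu h1 p q hℓ)
    rw [ENNReal.toReal_add (by finiteness) (by finiteness [hT (cell p q ℓ)])] at h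
    simpa [ENNReal.toReal_mul, ENNReal.toReal_ofReal, sq_nonneg] using h
  · intro p q ℓ t hℓ ht
    have h := ENNReal.toReal_mono (hunc p q ℓ t hℓ ht) (local_uncertainty α hu p q hℓ ht)
    rwa [ENNReal.toReal_pow, ENNReal.toReal_add (ENNReal.mul_ne_top ENNReal.ofReal_ne_top (hM _))
      (ENNReal.mul_ne_top ENNReal.ofReal_ne_top (hT _)), ENNReal.toReal_mul, ENNReal.toReal_mul,
      ENNReal.toReal_ofReal (by positivity), ENNReal.toReal_ofReal (by positivity)] at h
  · intro p q ℓ hℓ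
    have hℓ2 : 0 < ℓ / 2 := by positivity
    rw [setLIntegral_cell_split _ p q hℓ,
      ENNReal.toReal_add (ENNReal.add_ne_top.2 ⟨hR _ _ _ hℓ2, hR _ _ _ hℓ2⟩)
        (ENNReal.add_ne_top.2 ⟨hR _ _ _ hℓ2, hR _ _ _ hℓ2⟩),
      ENNReal.toReal_add (hR _ _ _ hℓ2) (hR _ _ _ hℓ2),
      ENNReal.toReal_add (hR _ _ _ hℓ2) (hR _ _ _ hℓ2)]
  · intro p q ℓ hℓ
    rw [kinetic_eq_kinDens α hu (measurableSet_cell p q ℓ), setLIntegral_cell_split _ p q hℓ]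
    simp_rw [← kinetic_eq_kinDens α hu (measurableSet_cell _ _ _)]
    rw [ENNReal.toReal_add (ENNReal.add_ne_top.2 ⟨hT _, hT _⟩)
        (ENNReal.add_ne_top.2 ⟨hT _, hT _⟩),
      ENNReal.toReal_add (hT _) (hT _), ENNReal.toReal_add (hT _) (hT _)]
  · intro p q ℓ hℓ hlt
    have h := hδm p q ℓ hℓ hlt
    rw [← mass_eq_dens hu (measurableSet_cell p q ℓ)] at h
    simpa using (ENNReal.toReal_lt_toReal (hM _) (by simp)).2 h
  · simpa using (ENNReal.toReal_le_toReal (by simp) (hM _)).2 h2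

lemma dens_eq_zero {Q : Set ℂ} (hQ : ∀ x, u x ≠ 0 → ∀ j, x j ∈ Q) {y : ℂ} (hy : y ∉ Q) :
    dens u y = 0 := by
  refine Finset.sum_eq_zero fun j _ => ?_
  rw [marg, lintegral_eq_zero_iff']
  all_goals
    have h : ∀ z : Fin n → ℂ, ENNReal.ofReal (‖u (j.insertNth y z)‖ ^ 2) = 0 := by
      intro z
      have : u (j.insertNth y z) = 0 := by
        by_contra h
        exact hy (by simpa using hQ _ h j)
      simp [this]
    simp_rw [h]
  · rfl
  · exact aemeasurable_const

lemma mass_eq_of_support (h1 : ∫⁻ x, ENNReal.ofReal (‖u x‖ ^ 2) = 1) {Q : Set ℂ}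
    (hQ : ∀ x, u x ≠ 0 → ∀ j, x j ∈ Q) : mass u Q = (n + 1 : ℕ) := by
  have h : mass u Q = ∑ _j : Fin (n + 1), ∫⁻ x, ENNReal.ofReal (‖u x‖ ^ 2) := by
    refine Finset.sum_congr rfl fun j _ => lintegral_congr fun x => ?_
    by_cases hx : u x = 0
    · simp [hx]
    · simp [occ, hQ x hx j]
  rw [h1] at h
  simpa using h

lemma potential_le_kinetic (α : ℝ) (hn : 2 ≤ n + 1) (hα : 0 < statC α (n + 1))
    (hu : IsAnyonWF (n + 1) u) (h1 : ∫⁻ x, ENNReal.ofReal (‖u x‖ ^ 2) = 1)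
    {W : ℂ → ℝ} (hW : Measurable W) (hW0 : ∀ y, 0 ≤ W y) (hWi : Integrable fun y => W y ^ 2) :
    ∑ j, ∫⁻ x, ENNReal.ofReal (W (x j) * ‖u x‖ ^ 2) ≤
      (∑ j, ∫⁻ x, ENNReal.ofReal (covSq α u j x)) +
        ENNReal.ofReal (325 * (statC α (n + 1) ^ 2)⁻¹ * ∫ y, W y ^ 2) := by
  by_cases hfin : ∑ j, ∫⁻ x, ENNReal.ofReal (covSq α u j x) = ⊤
  · simp [hfin]
  obtain ⟨p, ℓ, hℓ, hQ⟩ := exists_cell_support hu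
  set K := 1298 / statC α (n + 1) ^ 2 with hK
  have hK0 : 0 < K := by positivity
  have hd := measurable_dens hu
  have hmass : 2 ≤ mass u (cell p p ℓ) := by
    rw [mass_eq_of_support h1 hQ]
    exact_mod_cast hn
  calc ∑ j, ∫⁻ x, ENNReal.ofReal (W (x j) * ‖u x‖ ^ 2)
      = ∫⁻ y, ENNReal.ofReal (W y) * dens u y := by
        rw [← sum_lintegral_mul_eq_dens hu hW.ennreal_ofReal]
        simp_rw [ENNReal.ofReal_mul (hW0 _)]
    _ = ∫⁻ y in cell p p ℓ, ENNReal.ofReal (W y) * dens u y := by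
        refine (setLIntegral_eq_of_support_subset fun y hy => ?_).symm
        by_contra h
        exact hy (by simp [dens_eq_zero hQ h])
    _ ≤ ∫⁻ y in cell p p ℓ, (ENNReal.ofReal (1 / K) * dens u y ^ 2 +
          ENNReal.ofReal (K / 4) * ENNReal.ofReal (W y ^ 2)) :=
        lintegral_mono fun y => ofReal_mul_le_weighted hK0 (hW0 y) _
    _ = ENNReal.ofReal (1 / K) * (∫⁻ y in cell p p ℓ, dens u y ^ 2) +
          ENNReal.ofReal (K / 4) * ∫⁻ y in cell p p ℓ, ENNReal.ofReal (W y ^ 2) := by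
        rw [lintegral_add_left ((hd.pow_const 2).const_mul _),
          lintegral_const_mul _ (hd.pow_const 2),
          lintegral_const_mul _ (hW.pow_const 2).ennreal_ofReal]
    _ ≤ ENNReal.ofReal (1 / K) * (ENNReal.ofReal K *
          ∑ j, ∫⁻ x, ENNReal.ofReal (covSq α u j x)) +
          ENNReal.ofReal (K / 4) * ∫⁻ y, ENNReal.ofReal (W y ^ 2) := by
        refine add_le_add (mul_le_mul_right ?_ _) (mul_le_mul_right (setLIntegral_le_lintegral _ _) _)
        exact (lintegral_dens_sq_le α hn hα hu h1 hfin p p hℓ hmass).trans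
          (mul_le_mul_right (kinetic_le α u _) _)
    _ ≤ _ := by
        rw [← mul_assoc, ← ENNReal.ofReal_mul (by positivity), one_div_mul_cancel hK0.ne',
          ENNReal.ofReal_one, one_mul,
          ← ofReal_integral_eq_lintegral_ofReal hWi (ae_of_all _ fun y => by positivity),
          ← ENNReal.ofReal_mul (by positivity)]
        refine add_le_add_right (ENNReal.ofReal_le_ofReal
          (mul_le_mul_of_nonneg_right ?_ (integral_nonneg fun y => by positivity))) _
        rw [hK, ← div_eq_mul_inv, div_div, div_le_div_iff₀ (by positivity) (by positivity)]
        nlinarith [sq_nonneg (statC α (n + 1))]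

end liebThirring

end Anyon

/-- **Corollary (Lieb–Thirring inequality for anyons).** There is a universal `C_LT > 0`
such that for every `α` and `N ≥ 2` with `C_{α,N} > 0`, every normalized `N`-anyon wave
function `u`, and every measurable `V : ℝ² → ℝ` with square-integrable negative part `V₋`,
`∑_j ∫ (|D_j u|² + V(x_j)|u|²) ≥ −C_LT · C_{α,N}⁻² · ∫ V₋²`.
The left-hand side is interpreted as an extended real number (`+∞` if the positive part of
the potential term fails to be integrable); splitting `V = V₊ − V₋`, the inequality is
stated equivalently in `[0,∞]` as
`∑_j ∫ V₋(x_j)|u|² ≤ ∑_j ∫ (|D_j u|² + V₊(x_j)|u|²) + C_LT · C_{α,N}⁻² · ∫ V₋²`. -/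
theorem lieb_thirring_anyons :
    ∃ C : ℝ, 0 < C ∧ ∀ (α : ℝ) (N : ℕ), 2 ≤ N → 0 < statC α N →
      ∀ u : (Fin N → ℂ) → ℂ, IsAnyonWF N u → (∫ x : Fin N → ℂ, ‖u x‖ ^ 2) = 1 →
      ∀ V : ℂ → ℝ, Measurable V → Integrable (fun y : ℂ => (max (-V y) 0) ^ 2) →
      ∑ j : Fin N, ∫⁻ x : Fin N → ℂ,
          ENNReal.ofReal (max (-V (x j)) 0 * ‖u x‖ ^ 2) ≤
        (∑ j : Fin N, ∫⁻ x : Fin N → ℂ,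
          ENNReal.ofReal (covSq α u j x + max (V (x j)) 0 * ‖u x‖ ^ 2)) +
        ENNReal.ofReal (C * (statC α N ^ 2)⁻¹ * ∫ y : ℂ, (max (-V y) 0) ^ 2) := by
  refine ⟨325, by norm_num, fun α N hN hα u hu h1 V hV hVi => ?_⟩
  obtain ⟨n, rfl⟩ : ∃ n, N = n + 1 := ⟨N - 1, by omega⟩
  refine (Anyon.potential_le_kinetic α hN hα hu (Anyon.lintegral_sq_eq_one hu h1)
    (W := fun y => max (-V y) 0) (hV.neg.max measurable_const) (fun y => le_max_right _ _)
    hVi).trans (add_le_add_left (Finset.sum_le_sum fun j _ => lintegral_mono fun x =>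
      ENNReal.ofReal_le_ofReal (le_add_of_nonneg_right (by positivity))) _)

end
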